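/- For f ∈ V_8 set k = (f,f)_6 and m = (f,k)_4. The six invariants f ↦ (f,f)_8, f ↦ ((f,f)_4,f)_8, f ↦ (k,k)_4, f ↦ (m,k)_4, f ↦ ((k,k)_2,k)_4 and f ↦ ((k,k)_2,m)_4, homogeneous of degrees 2, 3, 4, 5, 6 and 7 in the coefficients, form a homogeneous system of parameters of the algebra O(V_8)^{SL_2} of polynomial invariants of the binary octavic. -/

import Mathlib

open MvPolynomial

/-- The `k`-th transvectant of two binary forms `f` of degree `n` and `g` of degree `m`
(coefficients in a commutative `ℂ`-algebra `R`). -/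
noncomputable def transv {R : Type} [CommRing R] [Algebra ℂ R] (n m k : ℕ)
    (f g : MvPolynomial (Fin 2) R) : MvPolynomial (Fin 2) R :=
  ((((n - k).factorial * (m - k).factorial : ℕ) : ℂ) / ((n.factorial * m.factorial : ℕ) : ℂ)) •
    ∑ i ∈ Finset.range (k + 1),
      ((-1 : ℂ) ^ i * (k.choose i : ℂ)) •
        ((fun p => pderiv (0 : Fin 2) p)^[k - i] ((fun p => pderiv (1 : Fin 2) p)^[i] f) *
         (fun p => pderiv (0 : Fin 2) p)^[i] ((fun p => pderiv (1 : Fin 2) p)^[k - i] g))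

/-- The binary form of degree `n` with coefficient vector `a`,
`f = ∑ binom(n,i) aᵢ x^(n-i) y^i`. -/
noncomputable def formOf (n : ℕ) (a : Fin (n + 1) → ℂ) : MvPolynomial (Fin 2) ℂ :=
  ∑ i : Fin (n + 1), C ((n.choose (i : ℕ) : ℂ) * a i) * X 0 ^ (n - (i : ℕ)) * X 1 ^ (i : ℕ)

/-- The action of `SL₂(ℂ)` on binary forms: `(g · f)(v) = f (g⁻¹ v)`. -/
noncomputable def sl2Act (g : Matrix.SpecialLinearGroup (Fin 2) ℂ)
    (f : MvPolynomial (Fin 2) ℂ) : MvPolynomial (Fin 2) ℂ :=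
  aeval (fun i => ∑ j,
    (((g⁻¹ : Matrix.SpecialLinearGroup (Fin 2) ℂ) : Matrix (Fin 2) (Fin 2) ℂ) i j) • X j) f

/-- The coefficient vector of a binary form of degree `n`:
`aᵢ` is the coefficient of `x^(n-i) y^i` divided by `binom(n,i)`. -/
noncomputable def coeffOf (n : ℕ) (f : MvPolynomial (Fin 2) ℂ) (i : Fin (n + 1)) : ℂ :=
  coeff (Finsupp.single 0 (n - (i : ℕ)) + Finsupp.single 1 (i : ℕ)) f / (n.choose (i : ℕ) : ℂ)

/-- The graded algebra `O(V_n)^{SL₂}` of polynomial invariants of the binary form of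
degree `n`: polynomials `P` in the coefficients `a₀, …, aₙ` such that `P` takes the same
value at the coefficients of `g · f` as at the coefficients of `f`, for every
`g ∈ SL₂(ℂ)` and every `f ∈ Vₙ`. -/
noncomputable def invariantAlgebra (n : ℕ) : Subalgebra ℂ (MvPolynomial (Fin (n + 1)) ℂ) :=
  ⨅ p : Matrix.SpecialLinearGroup (Fin 2) ℂ × (Fin (n + 1) → ℂ),
    AlgHom.equalizer
      (aeval (coeffOf n (sl2Act p.1 (formOf n p.2))) : MvPolynomial (Fin (n + 1)) ℂ →ₐ[ℂ] ℂ)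
      (aeval p.2)

/-- `v` is a homogeneous system of parameters of `O(V_n)^{SL₂}`: a family of homogeneous
invariants, algebraically independent over `ℂ`, such that `O(V_n)^{SL₂}` is a finitely
generated module over the `ℂ`-subalgebra they generate. -/
def IsHSOP (n : ℕ) {ι : Type} [Fintype ι] (v : ι → MvPolynomial (Fin (n + 1)) ℂ) : Prop :=
  (∀ i, v i ∈ invariantAlgebra n) ∧
  (∀ i, ∃ d : ℕ, (v i).IsHomogeneous d) ∧
  AlgebraicIndependent ℂ v ∧
  ∃ F : Finset (MvPolynomial (Fin (n + 1)) ℂ),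
    (F : Set (MvPolynomial (Fin (n + 1)) ℂ)) ⊆
      (invariantAlgebra n : Set (MvPolynomial (Fin (n + 1)) ℂ)) ∧
    ∀ x ∈ invariantAlgebra n,
      x ∈ Submodule.span (Algebra.adjoin ℂ (Set.range v))
        (F : Set (MvPolynomial (Fin (n + 1)) ℂ))

/-- The generic binary form of degree `n`, with coefficients the variables
`a₀, …, aₙ` of the polynomial ring `ℂ[a₀, …, aₙ]`. -/
noncomputable def genForm (n : ℕ) : MvPolynomial (Fin 2) (MvPolynomial (Fin (n + 1)) ℂ) :=
  ∑ i : Fin (n + 1),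
    MvPolynomial.C (MvPolynomial.C (n.choose (i : ℕ) : ℂ) * MvPolynomial.X i) *
      MvPolynomial.X (0 : Fin 2) ^ (n - (i : ℕ)) * MvPolynomial.X (1 : Fin 2) ^ (i : ℕ)

/-- The covariant `k = (f,f)₆ ∈ V₄` of the generic binary octavic. -/
noncomputable def octK : MvPolynomial (Fin 2) (MvPolynomial (Fin 9) ℂ) :=
  transv 8 8 6 (genForm 8) (genForm 8)

/-- The covariant `m = (f,k)₄ ∈ V₄` of the generic binary octavic. -/
noncomputable def octM : MvPolynomial (Fin 2) (MvPolynomial (Fin 9) ℂ) :=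
  transv 8 4 4 (genForm 8) octK

/-- The invariant `f ↦ (f,f)₈` of the binary octavic. -/
noncomputable def octI2 : MvPolynomial (Fin 9) ℂ :=
  coeff 0 (transv 8 8 8 (genForm 8) (genForm 8))

/-- The invariant `f ↦ ((f,f)₄,f)₈` of the binary octavic. -/
noncomputable def octI3 : MvPolynomial (Fin 9) ℂ :=
  coeff 0 (transv 8 8 8 (transv 8 8 4 (genForm 8) (genForm 8)) (genForm 8))

/-- The invariant `f ↦ (k,k)₄` of the binary octavic. -/
noncomputable def octI4 : MvPolynomial (Fin 9) ℂ :=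
  coeff 0 (transv 4 4 4 octK octK)

/-- The invariant `f ↦ (m,k)₄` of the binary octavic. -/
noncomputable def octI5 : MvPolynomial (Fin 9) ℂ :=
  coeff 0 (transv 4 4 4 octM octK)

/-- The invariant `f ↦ ((k,k)₂,k)₄` of the binary octavic. -/
noncomputable def octI6 : MvPolynomial (Fin 9) ℂ :=
  coeff 0 (transv 4 4 4 (transv 4 4 2 octK octK) octK)

/-- The invariant `f ↦ ((k,k)₂,m)₄` of the binary octavic. -/
noncomputable def octI7 : MvPolynomial (Fin 9) ℂ :=
  coeff 0 (transv 4 4 4 (transv 4 4 2 octK octK) octM)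

namespace BinaryForm

section Transvectant

variable {R : Type} [CommRing R]

/-- The binary form `∑ binom(n,i) aᵢ x^(n-i) y^i` with coefficients in `R`. -/
noncomputable def bform (n : ℕ) (a : ℕ → R) : MvPolynomial (Fin 2) R :=
  ∑ i ∈ Finset.range (n + 1), C ((n.choose i : R) * a i) * X 0 ^ (n - i) * X 1 ^ i

theorem pderiv_zero_bform (n : ℕ) (a : ℕ → R) :
    pderiv 0 (bform (n + 1) a) = ((n + 1 : ℕ) : MvPolynomial (Fin 2) R) * bform n a := by
  unfold bform
  rw [Finset.sum_range_succ, map_add, map_sum, Finset.mul_sum]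
  have h : pderiv (0 : Fin 2) (C (((n + 1).choose (n + 1) : R) * a (n + 1)) * X 0 ^ (n + 1 - (n + 1))
      * X 1 ^ (n + 1) : MvPolynomial (Fin 2) R) = 0 := by
    simp [pderiv_X]
  rw [h, add_zero]
  refine Finset.sum_congr rfl fun i hi => ?_
  have hi' : i ≤ n := by simpa [Nat.lt_succ_iff] using hi
  obtain ⟨m, rfl⟩ := Nat.exists_eq_add_of_le hi'
  have e1 : i + m + 1 - i = m + 1 := by omega
  have e2 : i + m - i = m := by omega
  have key := congrArg (Nat.cast (R := MvPolynomial (Fin 2) R)) (Nat.choose_mul_succ_eq (i + m) i)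
  rw [e1] at key ⊢
  rw [e2]
  simp only [pderiv_mul, pderiv_pow, pderiv_X, pderiv_C, map_mul, map_natCast] at key ⊢
  simp only [Pi.single_apply]
  push_cast at key ⊢
  simp
  linear_combination (- C (a i) * X 0 ^ m * X 1 ^ i) * key

theorem pderiv_one_bform (n : ℕ) (a : ℕ → R) :
    pderiv 1 (bform (n + 1) a) =
      ((n + 1 : ℕ) : MvPolynomial (Fin 2) R) * bform n (fun i => a (i + 1)) := by
  unfold bform
  rw [Finset.sum_range_succ', map_add, map_sum, Finset.mul_sum]
  have h : pderiv (1 : Fin 2) (C (((n + 1).choose 0 : R) * a 0) * X 0 ^ (n + 1 - 0)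
      * X 1 ^ 0 : MvPolynomial (Fin 2) R) = 0 := by
    simp [pderiv_X]
  rw [h, add_zero]
  refine Finset.sum_congr rfl fun i _ => ?_
  have key := congrArg (Nat.cast (R := MvPolynomial (Fin 2) R)) (Nat.add_one_mul_choose_eq n i)
  have e : n + 1 - (i + 1) = n - i := by omega
  rw [e]
  simp only [pderiv_mul, pderiv_pow, pderiv_X, pderiv_C, map_mul, map_natCast] at key ⊢
  simp only [Pi.single_apply]
  push_cast at key ⊢
  simp
  linear_combination (- C (a (i+1)) * X 0 ^ (n - i) * X 1 ^ i) * key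

variable [Algebra ℂ R]

theorem iterate_pderiv_one_bform (p i : ℕ) (a : ℕ → R) :
    (fun f => pderiv (1 : Fin 2) f)^[i] (bform (p + i) a) =
      (((p + i).factorial : ℂ) / (p.factorial : ℂ)) • bform p (fun j => a (j + i)) := by
  induction i generalizing p a with
  | zero => simp [div_self (Nat.cast_ne_zero.mpr p.factorial_ne_zero : (p.factorial : ℂ) ≠ 0)]
  | succ i ih =>
    rw [Function.iterate_succ_apply', show p + (i + 1) = (p + 1) + i by ring, ih]
    rw [Derivation.map_smul_of_tower, pderiv_one_bform, ← nsmul_eq_mul,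
      ← Nat.cast_smul_eq_nsmul ℂ, smul_smul, Nat.factorial_succ p]
    congr 1
    · push_cast
      have : (p : ℂ) + 1 ≠ 0 := by exact_mod_cast p.succ_ne_zero
      have : (p.factorial : ℂ) ≠ 0 := by exact_mod_cast p.factorial_ne_zero
      field_simp
    · simp [add_assoc, add_comm 1 i]

theorem iterate_pderiv_zero_bform (p i : ℕ) (a : ℕ → R) :
    (fun f => pderiv (0 : Fin 2) f)^[i] (bform (p + i) a) =
      (((p + i).factorial : ℂ) / (p.factorial : ℂ)) • bform p a := by
  induction i generalizing p a with
  | zero => simp [div_self (Nat.cast_ne_zero.mpr p.factorial_ne_zero : (p.factorial : ℂ) ≠ 0)]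
  | succ i ih =>
    rw [Function.iterate_succ_apply', show p + (i + 1) = (p + 1) + i by ring, ih]
    rw [Derivation.map_smul_of_tower, pderiv_zero_bform, ← nsmul_eq_mul,
      ← Nat.cast_smul_eq_nsmul ℂ, smul_smul, Nat.factorial_succ p]
    congr 1
    push_cast
    have : (p : ℂ) + 1 ≠ 0 := by exact_mod_cast p.succ_ne_zero
    have : (p.factorial : ℂ) ≠ 0 := by exact_mod_cast p.factorial_ne_zero
    field_simp

theorem iterate_pderiv_smul (j : ℕ) (l : Fin 2) (c : ℂ) (f : MvPolynomial (Fin 2) R) :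
    (fun f => pderiv l f)^[j] (c • f) = c • (fun f => pderiv l f)^[j] f := by
  induction j with
  | zero => rfl
  | succ j ih => simp only [Function.iterate_succ_apply', ih, Derivation.map_smul_of_tower]

theorem iterate_pderiv_bform (p i j : ℕ) (a : ℕ → R) :
    (fun f => pderiv (0 : Fin 2) f)^[j] ((fun f => pderiv (1 : Fin 2) f)^[i] (bform (p + (i + j)) a)) =
      (((p + (i + j)).factorial : ℂ) / (p.factorial : ℂ)) • bform p (fun l => a (l + i)) := by
  rw [show p + (i + j) = p + j + i by ring, iterate_pderiv_one_bform, iterate_pderiv_smul j,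
    iterate_pderiv_zero_bform, smul_smul]
  congr 1
  have : ((p + j).factorial : ℂ) ≠ 0 := by exact_mod_cast (p + j).factorial_ne_zero
  field_simp

theorem transv_bform_eq_sum (p q k : ℕ) (a b : ℕ → R) :
    transv (p + k) (q + k) k (bform (p + k) a) (bform (q + k) b) =
      ∑ i ∈ Finset.range (k + 1), ((-1 : ℂ) ^ i * (k.choose i : ℂ)) •
        (bform p (fun l => a (l + i)) * bform q (fun l => b (l + (k - i)))) := by
  unfold transv
  rw [Finset.smul_sum]
  refine Finset.sum_congr rfl fun i hi => ?_
  have hi' : i ≤ k := by simpa [Nat.lt_succ_iff] using hi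
  have ha := iterate_pderiv_bform p i (k - i) a
  have hb := iterate_pderiv_bform q (k - i) i b
  rw [Nat.add_sub_cancel' hi'] at ha
  rw [Nat.sub_add_cancel hi'] at hb
  rw [ha, hb, smul_mul_smul_comm, smul_smul, smul_smul]
  congr 1
  have h1 : ∀ n : ℕ, (n.factorial : ℂ) ≠ 0 := fun n => by exact_mod_cast n.factorial_ne_zero
  simp only [Nat.add_sub_cancel]
  push_cast
  field_simp [h1]

/-- Normalised coefficients of the product of two binary forms. -/
noncomputable def mulCoeff (p q : ℕ) (a b : ℕ → R) (j : ℕ) : R :=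
  ∑ x ∈ Finset.HasAntidiagonal.antidiagonal j,
    ((p.choose x.1 * q.choose x.2 : ℂ) / ((p + q).choose j : ℂ)) • (a x.1 * b x.2)

theorem bform_mul (p q : ℕ) (a b : ℕ → R) :
    bform p a * bform q b = bform (p + q) (mulCoeff p q a b) := by
  unfold bform mulCoeff
  have step : ∀ j ∈ Finset.range (p + q + 1),
      (C (((p + q).choose j : R) * ∑ x ∈ Finset.HasAntidiagonal.antidiagonal j,
        ((p.choose x.1 * q.choose x.2 : ℂ) / ((p + q).choose j : ℂ)) • (a x.1 * b x.2)) *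
        X 0 ^ (p + q - j) * X 1 ^ j : MvPolynomial (Fin 2) R) =
      ∑ x ∈ Finset.HasAntidiagonal.antidiagonal j, C ((p.choose x.1 : R) * a x.1) * C ((q.choose x.2 : R) * b x.2) *
        X 0 ^ (p - x.1 + (q - x.2)) * X 1 ^ (x.1 + x.2) := by
    intro j hj
    have hj' : j ≤ p + q := by simpa [Nat.lt_succ_iff] using hj
    have hc : ((p + q).choose j : ℂ) ≠ 0 := by exact_mod_cast (Nat.choose_pos hj').ne'
    rw [Finset.mul_sum, map_sum, Finset.sum_mul, Finset.sum_mul]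
    refine Finset.sum_congr rfl fun x hx => ?_
    have hx' : x.1 + x.2 = j := by simpa using hx
    by_cases h1 : x.1 ≤ p
    · by_cases h2 : x.2 ≤ q
      · rw [show p + q - j = p - x.1 + (q - x.2) by omega, hx', ← map_mul]
        congr 3
        rw [← nsmul_eq_mul, ← Nat.cast_smul_eq_nsmul ℂ, smul_smul, mul_div_cancel₀ _ hc, mul_smul,
          Nat.cast_smul_eq_nsmul, Nat.cast_smul_eq_nsmul, nsmul_eq_mul, nsmul_eq_mul]
        ring
      · simp [Nat.choose_eq_zero_of_lt (not_le.mp h2)]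
    · simp [Nat.choose_eq_zero_of_lt (not_le.mp h1)]
  rw [Finset.sum_congr rfl step, Finset.sum_mul_sum, ← Finset.sum_product', Finset.sum_sigma']
  symm
  refine Finset.sum_bij_ne_zero (fun x _ _ => x.2) ?_ ?_ ?_ ?_
  · rintro ⟨j, u, v⟩ h hne
    have hu : u ≤ p := by
      by_contra hu
      simp [Nat.choose_eq_zero_of_lt (not_le.mp hu)] at hne
    have hv : v ≤ q := by
      by_contra hv
      simp [Nat.choose_eq_zero_of_lt (not_le.mp hv)] at hne
    simp only [Finset.mem_product, Finset.mem_range]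
    omega
  · rintro ⟨j, u, v⟩ h _ ⟨j', u', v'⟩ h' _ heq
    simp only [Finset.mem_sigma, Finset.mem_range, Finset.HasAntidiagonal.mem_antidiagonal, Prod.mk.injEq] at h h' heq
    obtain ⟨rfl, rfl⟩ := heq
    obtain rfl : j = j' := h.2.symm.trans h'.2
    rfl
  · rintro ⟨u, v⟩ h hne
    simp only [Finset.mem_product, Finset.mem_range] at h
    refine ⟨⟨u + v, u, v⟩, ?_, ?_, rfl⟩
    · simp only [Finset.mem_sigma, Finset.mem_range, Finset.HasAntidiagonal.mem_antidiagonal, and_true]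
      omega
    · intro h0
      apply hne
      rw [← h0]
      ring
  · rintro ⟨j, u, v⟩ h hne
    ring

/-- Normalised coefficients of the `k`-th transvectant of forms of degrees `p + k` and `q + k`. -/
noncomputable def transvCoeff (p q k : ℕ) (a b : ℕ → R) (j : ℕ) : R :=
  ∑ i ∈ Finset.range (k + 1), ((-1 : ℂ) ^ i * (k.choose i : ℂ)) •
    mulCoeff p q (fun l => a (l + i)) (fun l => b (l + (k - i))) j

theorem sum_smul_bform {ι : Type*} (s : Finset ι) (n : ℕ) (c : ι → ℂ) (a : ι → ℕ → R) :
    ∑ i ∈ s, c i • bform n (a i) = bform n (fun j => ∑ i ∈ s, c i • a i j) := by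
  unfold bform
  simp only [Finset.smul_sum]
  rw [Finset.sum_comm]
  refine Finset.sum_congr rfl fun j _ => ?_
  simp only [Finset.mul_sum, map_sum, Finset.sum_mul]
  refine Finset.sum_congr rfl fun i _ => ?_
  rw [mul_smul_comm, show ∀ r : R, (C (c i • r) : MvPolynomial (Fin 2) R) = c i • C r from
    fun r => (smul_monomial (c i)).symm, smul_mul_assoc, smul_mul_assoc]

theorem transv_bform (p q k : ℕ) (a b : ℕ → R) :
    transv (p + k) (q + k) k (bform (p + k) a) (bform (q + k) b) =
      bform (p + q) (transvCoeff p q k a b) := by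
  rw [transv_bform_eq_sum]
  simp only [bform_mul]
  exact sum_smul_bform _ _ _ _

end Transvectant

variable {R : Type} [CommRing R]

/-- Extension of a coefficient vector by zero. -/
def extend {n : ℕ} (a : Fin n → R) (i : ℕ) : R := if h : i < n then a ⟨i, h⟩ else 0

theorem extend_coe {n : ℕ} (a : Fin n → R) (i : Fin n) : extend a i = a i := by
  simp [extend]

theorem map_extend {S : Type} [CommRing S] (φ : R →+* S) {n : ℕ} (a : Fin n → R) (i : ℕ) :
    φ (extend a i) = extend (fun j => φ (a j)) i := by
  unfold extend
  split_ifs <;> simp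

theorem formOf_eq_bform (n : ℕ) (a : Fin (n + 1) → ℂ) : formOf n a = bform n (extend a) := by
  unfold formOf bform
  rw [← Fin.sum_univ_eq_sum_range
    (fun i => C ((n.choose i : ℂ) * extend a i) * X 0 ^ (n - i) * X 1 ^ i)]
  simp only [extend_coe]

theorem genForm_eq_bform (n : ℕ) : genForm n = bform n (extend X) := by
  unfold genForm bform
  rw [← Fin.sum_univ_eq_sum_range (fun i => MvPolynomial.C
    ((n.choose i : MvPolynomial (Fin (n + 1)) ℂ) * extend X i) * X 0 ^ (n - i) * X 1 ^ i)]
  simp only [extend_coe, map_natCast]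

theorem coeff_zero_bform (a : ℕ → R) : coeff 0 (bform 0 a) = a 0 := by
  simp [bform]

theorem isHomogeneous_bform (n : ℕ) (a : ℕ → R) : (bform n a).IsHomogeneous n := by
  refine IsHomogeneous.sum _ _ _ fun i hi => ?_
  have hi' : i ≤ n := by simpa [Nat.lt_succ_iff] using hi
  have h := ((isHomogeneous_C (Fin 2) ((n.choose i : R) * a i)).mul
    (isHomogeneous_X_pow (R := R) (0 : Fin 2) (n - i))).mul (isHomogeneous_X_pow (R := R) (1 : Fin 2) i)
  rwa [show 0 + (n - i) + i = n by omega] at h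

variable [Algebra ℂ R]

/-- Coefficients of `(f,f)₆` for an octavic `f`. -/
noncomputable def kCoeff (a : ℕ → R) : ℕ → R := transvCoeff 2 2 6 a a

/-- Coefficients of `(f,k)₄` for an octavic `f` and `k = (f,f)₆`. -/
noncomputable def mCoeff (a : ℕ → R) : ℕ → R := transvCoeff 4 0 4 a (kCoeff a)

/-- Coefficients of `(k,k)₂` for an octavic `f` and `k = (f,f)₆`. -/
noncomputable def hCoeff (a : ℕ → R) : ℕ → R := transvCoeff 2 2 2 (kCoeff a) (kCoeff a)

/-- The six invariants of the octavic with coefficients `a`. -/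
noncomputable def octInv (a : ℕ → R) : Fin 6 → R :=
  ![transvCoeff 0 0 8 a a 0,
    transvCoeff 0 0 8 (transvCoeff 4 4 4 a a) a 0,
    transvCoeff 0 0 4 (kCoeff a) (kCoeff a) 0,
    transvCoeff 0 0 4 (mCoeff a) (kCoeff a) 0,
    transvCoeff 0 0 4 (hCoeff a) (kCoeff a) 0,
    transvCoeff 0 0 4 (hCoeff a) (mCoeff a) 0]

/-- The six invariants of an octavic form, as iterated transvectants. -/
noncomputable def formInv (f : MvPolynomial (Fin 2) R) : Fin 6 → R :=
  ![coeff 0 (transv 8 8 8 f f),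
    coeff 0 (transv 8 8 8 (transv 8 8 4 f f) f),
    coeff 0 (transv 4 4 4 (transv 8 8 6 f f) (transv 8 8 6 f f)),
    coeff 0 (transv 4 4 4 (transv 8 4 4 f (transv 8 8 6 f f)) (transv 8 8 6 f f)),
    coeff 0 (transv 4 4 4 (transv 4 4 2 (transv 8 8 6 f f) (transv 8 8 6 f f)) (transv 8 8 6 f f)),
    coeff 0 (transv 4 4 4 (transv 4 4 2 (transv 8 8 6 f f) (transv 8 8 6 f f))
      (transv 8 4 4 f (transv 8 8 6 f f)))]

theorem transv_eight_six_bform (a : ℕ → R) :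
    transv 8 8 6 (bform 8 a) (bform 8 a) = bform 4 (kCoeff a) :=
  transv_bform 2 2 6 a a

theorem formInv_bform (a : ℕ → R) : formInv (bform 8 a) = octInv a := by
  have h1 := transv_bform 0 0 8 a a
  have h2 := transv_bform 4 4 4 a a
  have h3 := transv_bform 0 0 8 (transvCoeff 4 4 4 a a) a
  have hm := transv_bform 4 0 4 a (kCoeff a)
  have hh := transv_bform 2 2 2 (kCoeff a) (kCoeff a)
  have h4 := fun b c : ℕ → R => transv_bform 0 0 4 b c
  simp only [Nat.reduceAdd, Nat.zero_add, Nat.add_zero] at h1 h2 h3 hm hh h4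
  unfold formInv octInv mCoeff hCoeff
  simp only [transv_eight_six_bform, h1, h2, h3, hm, hh, h4, coeff_zero_bform]

theorem octI_eq : ![octI2, octI3, octI4, octI5, octI6, octI7] = octInv (extend X) := by
  rw [← formInv_bform, ← genForm_eq_bform]
  rfl

section Naturality

variable {S : Type} [CommRing S] [Algebra ℂ S] (φ : R →ₐ[ℂ] S)

theorem map_transvCoeff (p q k : ℕ) (a b : ℕ → R) (j : ℕ) :
    φ (transvCoeff p q k a b j) = transvCoeff p q k (fun i => φ (a i)) (fun i => φ (b i)) j := by
  simp [transvCoeff, mulCoeff]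

theorem map_kCoeff (a : ℕ → R) (j : ℕ) : φ (kCoeff a j) = kCoeff (fun i => φ (a i)) j :=
  map_transvCoeff φ _ _ _ _ _ _

theorem map_octInv (a : ℕ → R) (j : Fin 6) : φ (octInv a j) = octInv (fun i => φ (a i)) j := by
  fin_cases j <;>
    simp [octInv, mCoeff, hCoeff, map_transvCoeff, map_kCoeff]

end Naturality

theorem aeval_octInv (a : Fin 9 → ℂ) (j : Fin 6) :
    aeval a (octInv (extend X : ℕ → MvPolynomial (Fin 9) ℂ) j) = octInv (extend a) j := by
  rw [map_octInv]
  congr 1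
  ext i
  rw [← AlgHom.coe_toRingHom, map_extend]
  simp

section Homogeneity

variable {σ : Type}

theorem isHomogeneous_transvCoeff (p q k d e : ℕ) {a b : ℕ → MvPolynomial σ ℂ}
    (ha : ∀ i, (a i).IsHomogeneous d) (hb : ∀ i, (b i).IsHomogeneous e) (j : ℕ) :
    (transvCoeff p q k a b j).IsHomogeneous (d + e) := by
  have hs : ∀ (c : ℂ) {f : MvPolynomial σ ℂ}, f.IsHomogeneous (d + e) →
      (c • f).IsHomogeneous (d + e) := fun c f hf =>
    (homogeneousSubmodule σ ℂ (d + e)).smul_mem c hf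
  exact IsHomogeneous.sum _ _ _ fun i _ => hs _ <|
    IsHomogeneous.sum _ _ _ fun x _ => hs _ ((ha _).mul (hb _))

theorem isHomogeneous_extend_X (n i : ℕ) :
    (extend X i : MvPolynomial (Fin n) ℂ).IsHomogeneous 1 := by
  unfold extend
  split_ifs
  · exact isHomogeneous_X _ _
  · exact isHomogeneous_zero _ _ _

theorem isHomogeneous_octInv (j : Fin 6) :
    (octInv (extend X : ℕ → MvPolynomial (Fin 9) ℂ) j).IsHomogeneous (j + 2) := by
  have h1 := isHomogeneous_extend_X 9
  have hk := isHomogeneous_transvCoeff 2 2 6 1 1 h1 h1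
  have hm := isHomogeneous_transvCoeff 4 0 4 1 2 h1 hk
  have hh := isHomogeneous_transvCoeff 2 2 2 2 2 hk hk
  fin_cases j
  · exact isHomogeneous_transvCoeff 0 0 8 1 1 h1 h1 0
  · exact isHomogeneous_transvCoeff 0 0 8 2 1 (isHomogeneous_transvCoeff 4 4 4 1 1 h1 h1) h1 0
  · exact isHomogeneous_transvCoeff 0 0 4 2 2 hk hk 0
  · exact isHomogeneous_transvCoeff 0 0 4 3 2 hm hk 0
  · exact isHomogeneous_transvCoeff 0 0 4 4 2 hh hk 0
  · exact isHomogeneous_transvCoeff 0 0 4 4 3 hh hm 0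

end Homogeneity

section Explicit

theorem octInv_zero (a : ℕ → R) : octInv a 0 =
    2 * (a 0 * a 8 - 8 * a 1 * a 7 + 28 * a 2 * a 6 - 56 * a 3 * a 5 + 35 * a 4 ^ 2) := by
  simp [octInv, transvCoeff, mulCoeff, Finset.sum_range_succ,
    Finset.Nat.sum_antidiagonal_eq_sum_range_succ_mk, Nat.choose]
  algebra

theorem octInv_one (a : ℕ → R) : octInv a 1 =
    6 * (a 0 * a 4 * a 8 - 4 * a 0 * a 5 * a 7 + 3 * a 0 * a 6 ^ 2 - 4 * a 1 * a 3 * a 8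
      + 12 * a 1 * a 4 * a 7 - 8 * a 1 * a 5 * a 6 + 3 * a 2 ^ 2 * a 8 - 8 * a 2 * a 3 * a 7
      - 22 * a 2 * a 4 * a 6 + 24 * a 2 * a 5 ^ 2 + 24 * a 3 ^ 2 * a 6 - 36 * a 3 * a 4 * a 5
      + 15 * a 4 ^ 3) := by
  simp [octInv, transvCoeff, mulCoeff, Finset.sum_range_succ,
    Finset.Nat.sum_antidiagonal_eq_sum_range_succ_mk, Nat.choose]
  algebra

theorem kCoeff_zero (a : ℕ → R) : kCoeff a 0 =
    2 * (a 0 * a 6 - 6 * a 1 * a 5 + 15 * a 2 * a 4 - 10 * a 3 ^ 2) := by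
  simp [kCoeff, transvCoeff, mulCoeff, Finset.sum_range_succ, Nat.choose]
  algebra

theorem kCoeff_one (a : ℕ → R) : kCoeff a 1 =
    a 0 * a 7 - 5 * a 1 * a 6 + 9 * a 2 * a 5 - 5 * a 3 * a 4 := by
  simp [kCoeff, transvCoeff, mulCoeff, Finset.sum_range_succ,
    Finset.Nat.sum_antidiagonal_eq_sum_range_succ_mk, Nat.choose]
  algebra

theorem kCoeff_two (a : ℕ → R) : kCoeff a 2 =
    (3⁻¹ : ℂ) • (a 0 * a 8 - 2 * a 1 * a 7 - 8 * a 2 * a 6 + 34 * a 3 * a 5 - 25 * a 4 ^ 2) := by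
  simp [kCoeff, transvCoeff, mulCoeff, Finset.sum_range_succ,
    Finset.Nat.sum_antidiagonal_eq_sum_range_succ_mk, Nat.choose]
  algebra

theorem kCoeff_three (a : ℕ → R) : kCoeff a 3 =
    a 1 * a 8 - 5 * a 2 * a 7 + 9 * a 3 * a 6 - 5 * a 4 * a 5 := by
  simp [kCoeff, transvCoeff, mulCoeff, Finset.sum_range_succ,
    Finset.Nat.sum_antidiagonal_eq_sum_range_succ_mk, Nat.choose]
  algebra

theorem kCoeff_four (a : ℕ → R) : kCoeff a 4 =
    2 * (a 2 * a 8 - 6 * a 3 * a 7 + 15 * a 4 * a 6 - 10 * a 5 ^ 2) := by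
  simp [kCoeff, transvCoeff, mulCoeff, Finset.sum_range_succ,
    Finset.Nat.sum_antidiagonal_eq_sum_range_succ_mk, Nat.choose]
  algebra

theorem transvCoeff_zero_zero_four (b c : ℕ → R) : transvCoeff 0 0 4 b c 0 =
    b 0 * c 4 - 4 * b 1 * c 3 + 6 * b 2 * c 2 - 4 * b 3 * c 1 + b 4 * c 0 := by
  simp [transvCoeff, mulCoeff, Finset.sum_range_succ, Nat.choose]
  algebra

theorem octInv_two (a : ℕ → R) : octInv a 2 =
    2 * (kCoeff a 0 * kCoeff a 4 - 4 * kCoeff a 1 * kCoeff a 3 + 3 * kCoeff a 2 ^ 2) := by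
  refine (transvCoeff_zero_zero_four _ _).trans ?_
  ring

theorem transvCoeff_four_zero_four (b c : ℕ → R) {j : ℕ} (hj : j ≤ 4) :
    transvCoeff 4 0 4 b c j =
      b j * c 4 - 4 * b (j + 1) * c 3 + 6 * b (j + 2) * c 2 - 4 * b (j + 3) * c 1
        + b (j + 4) * c 0 := by
  interval_cases j <;>
  · simp [transvCoeff, mulCoeff, Finset.sum_range_succ,
      Finset.Nat.sum_antidiagonal_eq_sum_range_succ_mk, Nat.choose]
    algebra

theorem mCoeff_eq (a : ℕ → R) {j : ℕ} (hj : j ≤ 4) : mCoeff a j =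
    a j * kCoeff a 4 - 4 * a (j + 1) * kCoeff a 3 + 6 * a (j + 2) * kCoeff a 2
      - 4 * a (j + 3) * kCoeff a 1 + a (j + 4) * kCoeff a 0 :=
  transvCoeff_four_zero_four _ _ hj

theorem octInv_three (a : ℕ → R) : octInv a 3 =
    mCoeff a 0 * kCoeff a 4 - 4 * mCoeff a 1 * kCoeff a 3 + 6 * mCoeff a 2 * kCoeff a 2
      - 4 * mCoeff a 3 * kCoeff a 1 + mCoeff a 4 * kCoeff a 0 :=
  transvCoeff_zero_zero_four _ _

theorem octInv_five (a : ℕ → R) : octInv a 5 =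
    hCoeff a 0 * mCoeff a 4 - 4 * hCoeff a 1 * mCoeff a 3 + 6 * hCoeff a 2 * mCoeff a 2
      - 4 * hCoeff a 3 * mCoeff a 1 + hCoeff a 4 * mCoeff a 0 :=
  transvCoeff_zero_zero_four _ _

theorem transvCoeff_two_two_two_zero (b : ℕ → R) :
    transvCoeff 2 2 2 b b 0 = 2 * (b 0 * b 2 - b 1 ^ 2) := by
  simp [transvCoeff, mulCoeff, Finset.sum_range_succ, Nat.choose]
  algebra

theorem hCoeff_zero (a : ℕ → R) :
    hCoeff a 0 = 2 * (kCoeff a 0 * kCoeff a 2 - kCoeff a 1 ^ 2) :=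
  transvCoeff_two_two_two_zero _

theorem transvCoeff_two_two_two_one (b : ℕ → R) :
    transvCoeff 2 2 2 b b 1 = b 0 * b 3 - b 1 * b 2 := by
  simp [transvCoeff, mulCoeff, Finset.sum_range_succ,
    Finset.Nat.sum_antidiagonal_eq_sum_range_succ_mk, Nat.choose]
  algebra

theorem hCoeff_one (a : ℕ → R) :
    hCoeff a 1 = kCoeff a 0 * kCoeff a 3 - kCoeff a 1 * kCoeff a 2 :=
  transvCoeff_two_two_two_one _

theorem transvCoeff_two_two_two_two (b : ℕ → R) :
    transvCoeff 2 2 2 b b 2 = (3⁻¹ : ℂ) • (b 0 * b 4 + 2 * b 1 * b 3 - 3 * b 2 ^ 2) := by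
  simp [transvCoeff, mulCoeff, Finset.sum_range_succ,
    Finset.Nat.sum_antidiagonal_eq_sum_range_succ_mk, Nat.choose]
  algebra

theorem hCoeff_two (a : ℕ → R) :
    hCoeff a 2 = (3⁻¹ : ℂ) • (kCoeff a 0 * kCoeff a 4 + 2 * kCoeff a 1 * kCoeff a 3 - 3 * kCoeff a 2 ^ 2) :=
  transvCoeff_two_two_two_two _

theorem transvCoeff_two_two_two_three (b : ℕ → R) :
    transvCoeff 2 2 2 b b 3 = b 1 * b 4 - b 2 * b 3 := by
  simp [transvCoeff, mulCoeff, Finset.sum_range_succ,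
    Finset.Nat.sum_antidiagonal_eq_sum_range_succ_mk, Nat.choose]
  algebra

theorem hCoeff_three (a : ℕ → R) :
    hCoeff a 3 = kCoeff a 1 * kCoeff a 4 - kCoeff a 2 * kCoeff a 3 :=
  transvCoeff_two_two_two_three _

theorem transvCoeff_two_two_two_four (b : ℕ → R) :
    transvCoeff 2 2 2 b b 4 = 2 * (b 2 * b 4 - b 3 ^ 2) := by
  simp [transvCoeff, mulCoeff, Finset.sum_range_succ,
    Finset.Nat.sum_antidiagonal_eq_sum_range_succ_mk, Nat.choose]
  algebra

theorem hCoeff_four (a : ℕ → R) :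
    hCoeff a 4 = 2 * (kCoeff a 2 * kCoeff a 4 - kCoeff a 3 ^ 2) :=
  transvCoeff_two_two_two_four _

theorem octInv_four (a : ℕ → R) : octInv a 4 =
    6 * (kCoeff a 0 * kCoeff a 2 * kCoeff a 4 + 2 * kCoeff a 1 * kCoeff a 2 * kCoeff a 3
      - kCoeff a 2 ^ 3 - kCoeff a 0 * kCoeff a 3 ^ 2 - kCoeff a 1 ^ 2 * kCoeff a 4) := by
  refine (transvCoeff_zero_zero_four _ _).trans ?_
  rw [hCoeff_zero, hCoeff_one, hCoeff_two, hCoeff_three, hCoeff_four]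
  generalize kCoeff a = k
  algebra

end Explicit

section Equivariance

open scoped TensorProduct

/-- Linear substitution of variables in binary polynomials. -/
noncomputable def linSubst (M : Matrix (Fin 2) (Fin 2) ℂ) :
    MvPolynomial (Fin 2) ℂ →ₐ[ℂ] MvPolynomial (Fin 2) ℂ :=
  aeval fun i => ∑ j, M i j • X j

theorem pderiv_linSubst (M : Matrix (Fin 2) (Fin 2) ℂ) (l : Fin 2) (f : MvPolynomial (Fin 2) ℂ) :
    pderiv l (linSubst M f) = ∑ i, M i l • linSubst M (pderiv i f) := by
  induction f using MvPolynomial.induction_on with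
  | C c => simp [linSubst]
  | add f g hf hg => simp [hf, hg, Finset.sum_add_distrib, smul_add]
  | mul_X f n hf =>
    rw [map_mul, pderiv_mul, hf]
    have hX : pderiv l (linSubst M (X n)) = C (M n l) := by
      simp [linSubst, Fin.sum_univ_two, pderiv_X, Pi.single_apply, smul_eq_C_mul]
      fin_cases l <;> simp
    rw [hX]
    simp only [pderiv_mul, map_add, map_mul, smul_add, Finset.sum_add_distrib, Finset.sum_mul,
      smul_mul_assoc]
    congr 1
    simp only [pderiv_X, Pi.single_apply, apply_ite, map_one, map_zero, mul_one, mul_zero,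
      smul_zero]
    simp [smul_eq_C_mul, mul_comm]

/-- The partial derivative as a `ℂ`-linear map. -/
noncomputable def pderivLin (i : Fin 2) : Module.End ℂ (MvPolynomial (Fin 2) ℂ) :=
  (pderiv i : Derivation ℂ (MvPolynomial (Fin 2) ℂ) (MvPolynomial (Fin 2) ℂ)).toLinearMap

theorem pderivLin_pow_apply (i : Fin 2) (k : ℕ) (f : MvPolynomial (Fin 2) ℂ) :
    (pderivLin i ^ k) f = (fun p => pderiv i p)^[k] f := by
  rw [Module.End.pow_apply]
  rfl

theorem commute_pderivLin : Commute (pderivLin 0) (pderivLin 1) := by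
  have h : ⁅(pderiv 0 : Derivation ℂ (MvPolynomial (Fin 2) ℂ) (MvPolynomial (Fin 2) ℂ)),
      (pderiv 1 : Derivation ℂ (MvPolynomial (Fin 2) ℂ) (MvPolynomial (Fin 2) ℂ))⁆ = 0 := by
    apply derivation_ext
    intro i
    fin_cases i <;> simp [Derivation.commutator_apply, pderiv_X]
  refine LinearMap.ext fun f => sub_eq_zero.mp ?_
  have h2 := congrArg (fun D => D f) h
  simp only [Derivation.commutator_apply, Derivation.zero_apply] at h2
  exact h2

/-- Cayley's omega process on a tensor product of polynomial rings. -/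
noncomputable def omega :
    Module.End ℂ (MvPolynomial (Fin 2) ℂ ⊗[ℂ] MvPolynomial (Fin 2) ℂ) :=
  TensorProduct.map (pderivLin 0) (pderivLin 1) - TensorProduct.map (pderivLin 1) (pderivLin 0)

theorem omega_pow_tmul (k : ℕ) (f g : MvPolynomial (Fin 2) ℂ) :
    (omega ^ k) (f ⊗ₜ g) = ∑ i ∈ Finset.range (k + 1), ((-1 : ℂ) ^ i * (k.choose i : ℂ)) •
      ((pderivLin 0 ^ (k - i)) ((pderivLin 1 ^ i) f) ⊗ₜ[ℂ]
        (pderivLin 0 ^ i) ((pderivLin 1 ^ (k - i)) g)) := by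
  set A : Module.End ℂ (MvPolynomial (Fin 2) ℂ ⊗[ℂ] MvPolynomial (Fin 2) ℂ) :=
    TensorProduct.map (pderivLin 0) (pderivLin 1) with hA
  set B : Module.End ℂ (MvPolynomial (Fin 2) ℂ ⊗[ℂ] MvPolynomial (Fin 2) ℂ) :=
    TensorProduct.map (pderivLin 1) (pderivLin 0) with hB
  have hc : Commute ((-1 : ℂ) • B) A := by
    suffices h : Commute B A from h.smul_left _
    unfold Commute SemiconjBy
    rw [hA, hB, ← TensorProduct.map_mul, ← TensorProduct.map_mul, commute_pderivLin.eq]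
  have ho : omega = (-1 : ℂ) • B + A := by rw [omega, ← hA, ← hB]; module
  rw [ho, hc.add_pow, LinearMap.sum_apply]
  refine Finset.sum_congr rfl fun i _ => ?_
  have hi : ((-1 : ℂ) • B) ^ i * A ^ (k - i) * (k.choose i : Module.End ℂ _) =
      ((-1 : ℂ) ^ i * (k.choose i : ℂ)) • (A ^ (k - i) * B ^ i) := by
    rw [(hc.pow_pow i (k - i)).eq, smul_pow, mul_smul_comm,
      ← (Nat.cast_commute _ _).eq, ← nsmul_eq_mul, ← Nat.cast_smul_eq_nsmul ℂ, ← mul_smul, mul_comm]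
  rw [hi, hA, hB, TensorProduct.map_pow, TensorProduct.map_pow, LinearMap.smul_apply,
    Module.End.mul_apply, TensorProduct.map_tmul, TensorProduct.map_tmul,
    ← Module.End.mul_apply (pderivLin 1 ^ (k - i)),
    ← (commute_pderivLin.pow_pow i (k - i)).eq, Module.End.mul_apply]

theorem transv_eq_omega (n m k : ℕ) (f g : MvPolynomial (Fin 2) ℂ) :
    transv n m k f g =
      ((((n - k).factorial * (m - k).factorial : ℕ) : ℂ) / ((n.factorial * m.factorial : ℕ) : ℂ)) •
        LinearMap.mul' ℂ (MvPolynomial (Fin 2) ℂ) ((omega ^ k) (f ⊗ₜ g)) := by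
  rw [omega_pow_tmul, map_sum]
  simp only [map_smul, LinearMap.mul'_apply, pderivLin_pow_apply]
  rfl

theorem commute_omega_map_linSubst (M : Matrix (Fin 2) (Fin 2) ℂ) (hM : M.det = 1) :
    Commute omega
      (TensorProduct.map (linSubst M).toLinearMap (linSubst M).toLinearMap) := by
  refine TensorProduct.ext' fun f g => ?_
  have hd : ∀ l f, pderivLin l (linSubst M f) =
      M 0 l • linSubst M (pderivLin 0 f) + M 1 l • linSubst M (pderivLin 1 f) := fun l f => by
    have h := pderiv_linSubst M l f
    rwa [Fin.sum_univ_two] at h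
  rw [Matrix.det_fin_two] at hM
  simp only [omega, Module.End.mul_apply, TensorProduct.map_tmul, AlgHom.toLinearMap_apply,
    LinearMap.sub_apply, hd, map_sub, TensorProduct.add_tmul, TensorProduct.tmul_add,
    ← TensorProduct.smul_tmul', TensorProduct.tmul_smul]
  simp only [smul_add]
  linear_combination (norm := module)
    hM • ((linSubst M (pderivLin 0 f)) ⊗ₜ[ℂ] (linSubst M (pderivLin 1 g)) -
      (linSubst M (pderivLin 1 f)) ⊗ₜ[ℂ] (linSubst M (pderivLin 0 g)))

theorem transv_linSubst (M : Matrix (Fin 2) (Fin 2) ℂ) (hM : M.det = 1) (n m k : ℕ)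
    (f g : MvPolynomial (Fin 2) ℂ) :
    transv n m k (linSubst M f) (linSubst M g) = linSubst M (transv n m k f g) := by
  rw [transv_eq_omega, transv_eq_omega, map_smul]
  congr 1
  have h := LinearMap.congr_fun ((commute_omega_map_linSubst M hM).pow_left k).eq (f ⊗ₜ g)
  simp only [Module.End.mul_apply, TensorProduct.map_tmul, AlgHom.toLinearMap_apply] at h
  rw [h]
  generalize (omega ^ k) (f ⊗ₜ g) = t
  induction t using TensorProduct.induction_on with
  | zero => simp
  | tmul x y => simp
  | add x y hx hy => simp only [map_add, hx, hy]

theorem coeff_zero_linSubst (M : Matrix (Fin 2) (Fin 2) ℂ) (f : MvPolynomial (Fin 2) ℂ) :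
    coeff 0 (linSubst M f) = coeff 0 f := by
  have h : (aeval (fun _ => (0 : ℂ))).comp (linSubst M) = aeval (fun _ : Fin 2 => (0 : ℂ)) := by
    ext i
    simp [linSubst]
  have h2 := DFunLike.congr_fun h f
  simpa [aeval_zero', constantCoeff_eq] using h2

theorem formInv_linSubst (M : Matrix (Fin 2) (Fin 2) ℂ) (hM : M.det = 1)
    (f : MvPolynomial (Fin 2) ℂ) : formInv (linSubst M f) = formInv f := by
  simp only [formInv, transv_linSubst M hM, coeff_zero_linSubst]

end Equivariance

section Action

theorem coeff_bform {R : Type} [CommRing R] (n : ℕ) (a : ℕ → R) (m : Fin 2 →₀ ℕ) :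
    coeff m (bform n a) = if m 0 + m 1 = n then (n.choose (m 1) : R) * a (m 1) else 0 := by
  have key : ∀ i, C ((n.choose i : R) * a i) * X 0 ^ (n - i) * X 1 ^ i =
      monomial (Finsupp.single 0 (n - i) + Finsupp.single 1 i : Fin 2 →₀ ℕ)
        ((n.choose i : R) * a i) := fun i => by
    rw [X_pow_eq_monomial, X_pow_eq_monomial, C_mul_monomial, monomial_mul, mul_one, mul_one]
  have heq : ∀ i, (Finsupp.single 0 (n - i) + Finsupp.single 1 i : Fin 2 →₀ ℕ) = m ↔
      n - i = m 0 ∧ i = m 1 := fun i => by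
    simp [Finsupp.ext_iff, Fin.forall_fin_two]
  simp only [bform, key, coeff_sum, coeff_monomial, heq]
  split_ifs with h
  · rw [Finset.sum_eq_single (m 1)]
    · rw [if_pos ⟨by omega, rfl⟩]
    · exact fun i _ hi => if_neg fun hh => hi hh.2
    · intro hh
      simp at hh
      omega
  · refine Finset.sum_eq_zero fun i hi => if_neg fun hh => h ?_
    simp at hi
    omega

theorem coeffOf_bform (n : ℕ) (a : ℕ → ℂ) (i : Fin (n + 1)) : coeffOf n (bform n a) i = a i := by
  have h : ((n.choose i : ℕ) : ℂ) ≠ 0 := by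
    exact_mod_cast (Nat.choose_pos (Nat.lt_succ_iff.mp i.2)).ne'
  rw [coeffOf, coeff_bform]
  simp
  rw [if_pos (by omega)]
  field_simp

theorem coeffOf_formOf (n : ℕ) (a : Fin (n + 1) → ℂ) : coeffOf n (formOf n a) = a := by
  ext i
  rw [formOf_eq_bform, coeffOf_bform, extend_coe]

theorem formOf_coeffOf {n : ℕ} {f : MvPolynomial (Fin 2) ℂ} (hf : f.IsHomogeneous n) :
    formOf n (coeffOf n f) = f := by
  ext m
  rw [formOf_eq_bform, coeff_bform]
  split_ifs with h
  · have hm : m 1 < n + 1 := by omega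
    have hc : ((n.choose (m 1) : ℕ) : ℂ) ≠ 0 := by
      exact_mod_cast (Nat.choose_pos (Nat.lt_succ_iff.mp hm)).ne'
    have he : (Finsupp.single 0 (n - m 1) + Finsupp.single 1 (m 1) : Fin 2 →₀ ℕ) = m := by
      simp only [Finsupp.ext_iff, Fin.forall_fin_two]
      simp
      omega
    simp only [extend, hm, dif_pos, coeffOf, he]
    field_simp
  · refine (hf.coeff_eq_zero ?_).symm
    rwa [Finsupp.degree_eq_sum, Fin.sum_univ_two]

theorem bform_congr {R : Type} [CommRing R] {n : ℕ} {a b : ℕ → R} (h : ∀ i ≤ n, a i = b i) :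
    bform n a = bform n b :=
  Finset.sum_congr rfl fun i hi => by rw [h i (Nat.lt_succ_iff.mp (Finset.mem_range.mp hi))]

theorem isHomogeneous_linSubst (M : Matrix (Fin 2) (Fin 2) ℂ) {n : ℕ}
    {f : MvPolynomial (Fin 2) ℂ} (hf : f.IsHomogeneous n) : (linSubst M f).IsHomogeneous n := by
  have h := hf.aeval (fun i => ∑ j, M i j • (X j : MvPolynomial (Fin 2) ℂ)) (n := 1) fun i =>
    IsHomogeneous.sum _ _ _ fun j _ =>
      (homogeneousSubmodule (Fin 2) ℂ 1).smul_mem _ (isHomogeneous_X ℂ j)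
  rwa [one_mul] at h

theorem linSubst_linSubst (M N : Matrix (Fin 2) (Fin 2) ℂ) (f : MvPolynomial (Fin 2) ℂ) :
    linSubst M (linSubst N f) = linSubst (N * M) f := by
  have h : (linSubst M).comp (linSubst N) = linSubst (N * M) := by
    ext1 i
    simp only [linSubst, AlgHom.comp_apply, aeval_X, map_sum, map_smul, Matrix.mul_apply,
      Finset.sum_smul, Finset.smul_sum, mul_smul]
    exact Finset.sum_comm
  exact DFunLike.congr_fun h f

/-- The coefficient vector after a linear substitution of the variables. -/
noncomputable def act {n : ℕ} (M : Matrix (Fin 2) (Fin 2) ℂ) (a : Fin (n + 1) → ℂ) :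
    Fin (n + 1) → ℂ :=
  coeffOf n (linSubst M (formOf n a))

variable {n : ℕ}

theorem isHomogeneous_formOf (a : Fin (n + 1) → ℂ) : (formOf n a).IsHomogeneous n := by
  rw [formOf_eq_bform]
  exact isHomogeneous_bform _ _

theorem formOf_act (M : Matrix (Fin 2) (Fin 2) ℂ) (a : Fin (n + 1) → ℂ) :
    formOf n (act M a) = linSubst M (formOf n a) :=
  formOf_coeffOf (isHomogeneous_linSubst M (isHomogeneous_formOf a))

theorem act_act (M N : Matrix (Fin 2) (Fin 2) ℂ) (a : Fin (n + 1) → ℂ) :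
    act M (act N a) = act (N * M) a := by
  rw [act, formOf_act, linSubst_linSubst, act]

theorem mem_invariantAlgebra_iff {P : MvPolynomial (Fin (n + 1)) ℂ} :
    P ∈ invariantAlgebra n ↔ ∀ (M : Matrix (Fin 2) (Fin 2) ℂ) (_ : M.det = 1)
      (a : Fin (n + 1) → ℂ), aeval (act M a) P = aeval a P := by
  simp only [invariantAlgebra, Algebra.mem_iInf, AlgHom.mem_equalizer]
  constructor
  · intro h M hM a
    obtain ⟨g, rfl⟩ : ∃ g : Matrix.SpecialLinearGroup (Fin 2) ℂ,
      (g : Matrix (Fin 2) (Fin 2) ℂ) = M := ⟨⟨M, hM⟩, rfl⟩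
    have h2 := h (g⁻¹, a)
    simp only [sl2Act, inv_inv] at h2
    exact h2
  · intro h p
    exact h _ (p.1⁻¹).2 p.2

theorem octInv_act {M : Matrix (Fin 2) (Fin 2) ℂ} (hM : M.det = 1) (a : Fin 9 → ℂ) :
    octInv (extend (act M a)) = octInv (extend a) := by
  rw [← formInv_bform, ← formInv_bform, ← formOf_eq_bform 8, ← formOf_eq_bform 8, formOf_act,
    formInv_linSubst M hM]

theorem octInv_mem_invariantAlgebra (j : Fin 6) :
    octInv (extend X : ℕ → MvPolynomial (Fin 9) ℂ) j ∈ invariantAlgebra 8 := by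
  refine mem_invariantAlgebra_iff.mpr fun M hM a => ?_
  rw [aeval_octInv, aeval_octInv, octInv_act hM]

theorem kCoeff_act {M : Matrix (Fin 2) (Fin 2) ℂ} (hM : M.det = 1) (a : Fin 9 → ℂ) :
    (fun i : Fin 5 => kCoeff (extend (act M a)) i) =
      act M (fun i : Fin 5 => kCoeff (extend a) i) := by
  have hf : ∀ b : ℕ → ℂ, formOf 4 (fun i : Fin 5 => b i) = bform 4 b := fun b => by
    rw [formOf_eq_bform]
    refine bform_congr fun i hi => ?_
    simp [extend, Nat.lt_succ_iff.mpr hi]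
  rw [← coeffOf_formOf 4 (fun i : Fin 5 => kCoeff (extend (act M a)) i), hf,
    ← transv_eight_six_bform, ← formOf_eq_bform 8, formOf_act, transv_linSubst M hM, act, hf,
    formOf_eq_bform 8, transv_eight_six_bform]

end Action

section Unipotent

variable {n : ℕ}

theorem upper_term_expansion (c z : ℂ) {i : ℕ} (hi : i ≤ n) :
    C ((n.choose i : ℂ) * z) * (X 0 + C c * X 1) ^ (n - i) * X 1 ^ i =
      ∑ j ∈ Finset.Ico i (n + 1), C ((n.choose j : ℂ) * ((j.choose i : ℂ) * c ^ (j - i) * z)) *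
        X 0 ^ (n - j) * (X 1 : MvPolynomial (Fin 2) ℂ) ^ j := by
  rw [add_comm (X 0), add_pow, Finset.sum_Ico_eq_sum_range, show n + 1 - i = n - i + 1 by omega,
    Finset.mul_sum, Finset.sum_mul]
  refine Finset.sum_congr rfl fun l hl => ?_
  have hl' : l ≤ n - i := Nat.lt_succ_iff.mp (Finset.mem_range.mp hl)
  have hch : (n.choose i : ℂ) * ((n - i).choose l : ℂ) =
      (n.choose (i + l) : ℂ) * ((i + l).choose i : ℂ) := by
    have := Nat.choose_mul (n := n) (k := i + l) (s := i) (by omega)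
    rw [Nat.add_sub_cancel_left] at this
    exact_mod_cast this.symm
  have hz : (n.choose (i + l) : ℂ) * (((i + l).choose i : ℂ) * c ^ l * z) =
      (n.choose i : ℂ) * ((n - i).choose l : ℂ) * c ^ l * z := by rw [hch]; ring
  rw [show n - (i + l) = n - i - l by omega, Nat.add_sub_cancel_left, hz, pow_add, mul_pow]
  simp only [map_mul, map_pow, map_natCast]
  ring

theorem linSubst_upper_bform (c : ℂ) (a : ℕ → ℂ) :
    linSubst !![1, c; 0, 1] (bform n a) =
      bform n fun j => ∑ i ∈ Finset.range (j + 1), (j.choose i : ℂ) * c ^ (j - i) * a i := by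
  have h0 : linSubst !![1, c; 0, 1] (X 0) = X 0 + C c * X 1 := by
    simp [linSubst, Fin.sum_univ_two, smul_eq_C_mul]
  have h1 : linSubst !![1, c; 0, 1] (X 1) = X 1 := by
    simp [linSubst, Fin.sum_univ_two]
  have hC : ∀ z : ℂ, linSubst !![1, c; 0, 1] (C z) = C z := fun z => algHom_C _ z
  unfold bform
  rw [map_sum]
  have hL : ∀ i ∈ Finset.range (n + 1),
      linSubst !![1, c; 0, 1] (C ((n.choose i : ℂ) * a i) * X 0 ^ (n - i) * X 1 ^ i) =
      ∑ j ∈ Finset.Ico i (n + 1), C ((n.choose j : ℂ) * ((j.choose i : ℂ) * c ^ (j - i) * a i)) *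
        X 0 ^ (n - j) * (X 1 : MvPolynomial (Fin 2) ℂ) ^ j := fun i hi => by
    rw [map_mul, map_mul, map_pow, map_pow, h0, h1, hC,
      upper_term_expansion c _ (Nat.lt_succ_iff.mp (Finset.mem_range.mp hi))]
  rw [Finset.sum_congr rfl hL]
  have hR : ∀ j ∈ Finset.range (n + 1),
      C ((n.choose j : ℂ) * ∑ i ∈ Finset.range (j + 1), (j.choose i : ℂ) * c ^ (j - i) * a i) *
        X 0 ^ (n - j) * (X 1 : MvPolynomial (Fin 2) ℂ) ^ j =
      ∑ i ∈ Finset.range (j + 1), C ((n.choose j : ℂ) * ((j.choose i : ℂ) * c ^ (j - i) * a i)) *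
        X 0 ^ (n - j) * (X 1 : MvPolynomial (Fin 2) ℂ) ^ j := fun j _ => by
    rw [Finset.mul_sum, map_sum, Finset.sum_mul, Finset.sum_mul]
  rw [Finset.sum_congr rfl hR]
  refine Finset.sum_comm' fun x y => ?_
  simp only [Finset.mem_range, Finset.mem_Ico]
  omega

theorem act_upper (c : ℂ) (a : Fin (n + 1) → ℂ) (j : Fin (n + 1)) :
    act !![1, c; 0, 1] a j =
      ∑ i ∈ Finset.range (j + 1), ((j : ℕ).choose i : ℂ) * c ^ (j - i : ℕ) * extend a i := by
  rw [act, formOf_eq_bform, linSubst_upper_bform, coeffOf_bform]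

theorem linSubst_swap_bform (a : ℕ → ℂ) :
    linSubst !![0, 1; 1, 0] (bform n a) = bform n fun j => a (n - j) := by
  have h0 : linSubst !![0, 1; 1, 0] (X 0) = X 1 := by
    simp [linSubst, Fin.sum_univ_two]
  have h1 : linSubst !![0, 1; 1, 0] (X 1) = X 0 := by
    simp [linSubst, Fin.sum_univ_two]
  have hC : ∀ z : ℂ, linSubst !![0, 1; 1, 0] (C z) = C z := fun z => by
    simp [linSubst]
  simp only [bform, map_sum, map_mul (linSubst _), map_pow, h0, h1, hC]
  rw [← Finset.sum_range_reflect]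
  refine Finset.sum_congr rfl fun i hi => ?_
  have hi' : i ≤ n := Nat.lt_succ_iff.mp (Finset.mem_range.mp hi)
  rw [show n + 1 - 1 - i = n - i by omega, Nat.choose_symm hi', show n - (n - i) = i by omega]
  ring

theorem act_swap (a : Fin (n + 1) → ℂ) : act !![0, 1; 1, 0] a = fun j => a j.rev := by
  ext j
  rw [act, formOf_eq_bform, linSubst_swap_bform, coeffOf_bform]
  have := extend_coe a j.rev
  rwa [Fin.val_rev, show n + 1 - (j + 1 : ℕ) = n - j by omega] at this

end Unipotent

section Infinitesimal

variable {n : ℕ}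

/-- The derivation of the coefficient ring induced by `x ↦ x + t y`. -/
noncomputable def derE (n : ℕ) :
    Derivation ℂ (MvPolynomial (Fin (n + 1)) ℂ) (MvPolynomial (Fin (n + 1)) ℂ) :=
  mkDerivation ℂ fun j => ((j : ℕ) : ℂ) • extend X (j - 1)

/-- The derivation of the coefficient ring induced by `y ↦ y + t x`. -/
noncomputable def derF (n : ℕ) :
    Derivation ℂ (MvPolynomial (Fin (n + 1)) ℂ) (MvPolynomial (Fin (n + 1)) ℂ) :=
  mkDerivation ℂ fun j => ((n : ℂ) - (j : ℕ)) • extend X (j + 1)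

/-- The weight derivation of the coefficient ring. -/
noncomputable def derH (n : ℕ) :
    Derivation ℂ (MvPolynomial (Fin (n + 1)) ℂ) (MvPolynomial (Fin (n + 1)) ℂ) :=
  mkDerivation ℂ fun j => ((n : ℂ) - 2 * (j : ℕ)) • X j

theorem derF_eq_rename (P : MvPolynomial (Fin (n + 1)) ℂ) :
    derF n P = rename Fin.rev (derE n (rename Fin.rev P)) := by
  induction P using MvPolynomial.induction_on with
  | C c => simp
  | add p q hp hq => simp [hp, hq]
  | mul_X p j hp =>
    have hX : derF n (X j) = rename Fin.rev (derE n (X j.rev)) := by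
      have hj : (n : ℂ) - (j : ℕ) = ((j.rev : ℕ) : ℂ) := by
        rw [Fin.val_rev, Nat.cast_sub (by omega)]
        push_cast
        ring
      simp only [derF, derE, mkDerivation_X, map_smul]
      rw [hj]
      rcases Nat.eq_zero_or_pos (j.rev : ℕ) with h | h
      · rw [h, Nat.cast_zero, zero_smul, zero_smul]
      · congr 1
        rw [Fin.val_rev] at h ⊢
        rw [extend, dif_pos (by omega), extend, dif_pos (by omega), rename_X]
        congr 1
        ext
        simp [Fin.val_rev]
        omega
    rw [Derivation.leibniz, hp, hX, map_mul, Derivation.leibniz, map_add, rename_X]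
    have hp' : rename Fin.rev (rename Fin.rev p) = p := by
      rw [rename_rename, Fin.rev_involutive.comp_self, rename_id_apply]
    simp only [smul_eq_mul, map_mul, hp', rename_X, Fin.rev_rev]

/-- The orbit of a coefficient vector under `x ↦ x + t y`, as a polynomial in `t`. -/
noncomputable def orbitMap (a : Fin (n + 1) → ℂ) :
    MvPolynomial (Fin (n + 1)) ℂ →ₐ[ℂ] Polynomial ℂ :=
  aeval fun j => ∑ i ∈ Finset.range (j + 1),
    Polynomial.C (((j : ℕ).choose i : ℂ) * extend a i) * Polynomial.X ^ (j - i : ℕ)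

theorem eval_orbitMap (a : Fin (n + 1) → ℂ) (c : ℂ) (P : MvPolynomial (Fin (n + 1)) ℂ) :
    (orbitMap a P).eval c = aeval (act !![1, c; 0, 1] a) P := by
  have h : (Polynomial.aeval c).comp (orbitMap a) =
      (aeval (act !![1, c; 0, 1] a) : MvPolynomial (Fin (n + 1)) ℂ →ₐ[ℂ] ℂ) := by
    ext j
    simp only [orbitMap, AlgHom.comp_apply, aeval_X, act_upper, map_sum, map_mul, map_pow,
      Polynomial.aeval_X, Polynomial.aeval_C, Algebra.algebraMap_self, RingHom.id_apply]
    exact Finset.sum_congr rfl fun i _ => by ring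
  simpa [Polynomial.coe_aeval_eq_eval] using DFunLike.congr_fun h P

theorem derivative_orbitMap (a : Fin (n + 1) → ℂ) (P : MvPolynomial (Fin (n + 1)) ℂ) :
    Polynomial.derivative (orbitMap a P) = orbitMap a (derE n P) := by
  induction P using MvPolynomial.induction_on with
  | C c => simp [orbitMap]
  | add p q hp hq => simp [hp, hq]
  | mul_X p j hp =>
    have hX : Polynomial.derivative (orbitMap a (X j)) = orbitMap a (derE n (X j)) := by
      obtain ⟨j, hj⟩ := j
      cases j with
      | zero => simp [derE, orbitMap]
      | succ j =>
        simp only [derE, mkDerivation_X, map_smul, Nat.add_sub_cancel]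
        rw [extend, dif_pos (by omega)]
        simp only [orbitMap, aeval_X, map_sum]
        rw [Finset.sum_range_succ, Nat.sub_self, pow_zero, mul_one,
          Polynomial.derivative_C, add_zero]
        simp only [Polynomial.derivative_mul, Polynomial.derivative_C, Polynomial.derivative_X_pow,
          zero_mul, Finset.smul_sum, zero_add, Polynomial.smul_eq_C_mul]
        refine Finset.sum_congr rfl fun i hi => ?_
        have hi' : i ≤ j := Nat.lt_succ_iff.mp (Finset.mem_range.mp hi)
        have hc := congrArg (Nat.cast (R := ℂ)) (Nat.choose_mul_succ_eq j i)
        rw [show j + 1 - i - 1 = j - i by omega, ← mul_assoc, ← mul_assoc, ← map_mul, ← map_mul]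
        congr 2
        push_cast at hc ⊢
        linear_combination (-extend a i) * hc
    rw [Derivation.leibniz, map_mul, Polynomial.derivative_mul, hp, hX, map_add, smul_eq_mul,
      smul_eq_mul, map_mul, map_mul]
    ring

theorem act_upper_zero (a : Fin (n + 1) → ℂ) : act !![1, 0; 0, 1] a = a := by
  have h : linSubst !![1, 0; 0, 1] = AlgHom.id ℂ _ := by
    ext1 i
    fin_cases i <;> simp [linSubst, Fin.sum_univ_two]
  rw [act, h, AlgHom.id_apply, coeffOf_formOf]

theorem derE_eq_zero_iff (P : MvPolynomial (Fin (n + 1)) ℂ) :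
    derE n P = 0 ↔ ∀ (c : ℂ) (a : Fin (n + 1) → ℂ),
      aeval (act !![1, c; 0, 1] a) P = aeval a P := by
  constructor
  · intro h c a
    have hd := derivative_orbitMap a P
    rw [h, map_zero] at hd
    have h0 := Polynomial.derivative_eq_zero.mp hd
    have h1 := eval_orbitMap a c P
    have h2 := eval_orbitMap a 0 P
    rw [act_upper_zero] at h2
    rw [Polynomial.eq_C_of_natDegree_eq_zero h0, Polynomial.eval_C] at h1 h2
    rw [← h1, h2]
  · intro h
    refine MvPolynomial.funext fun a => ?_
    have hc : orbitMap a P = Polynomial.C (aeval a P) := by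
      refine Polynomial.funext fun c => ?_
      rw [eval_orbitMap, h, Polynomial.eval_C]
    have hd := derivative_orbitMap a P
    rw [hc, Polynomial.derivative_C] at hd
    have h2 := eval_orbitMap a 0 (derE n P)
    rw [act_upper_zero, ← hd, Polynomial.eval_zero] at h2
    simpa [aeval_eq_eval] using h2.symm

theorem aeval_act_swap (a : Fin (n + 1) → ℂ) (P : MvPolynomial (Fin (n + 1)) ℂ) :
    aeval (act !![0, 1; 1, 0] a) P = aeval a (rename Fin.rev P) := by
  rw [act_swap, aeval_rename]
  rfl

theorem act_lower (c : ℂ) (a : Fin (n + 1) → ℂ) :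
    act !![1, 0; c, 1] a =
      act !![0, 1; 1, 0] (act !![1, c; 0, 1] (act !![0, 1; 1, 0] a)) := by
  rw [act_act, act_act]
  congr 1
  ext i j
  fin_cases i <;> fin_cases j <;> simp [Matrix.mul_apply, Fin.sum_univ_two]

theorem derF_eq_zero_iff (P : MvPolynomial (Fin (n + 1)) ℂ) :
    derF n P = 0 ↔ ∀ (c : ℂ) (a : Fin (n + 1) → ℂ),
      aeval (act !![1, 0; c, 1] a) P = aeval a P := by
  have hW : ∀ a : Fin (n + 1) → ℂ, act !![0, 1; 1, 0] (act !![0, 1; 1, 0] a) = a := fun a => by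
    simp [act_swap]
  rw [derF_eq_rename, map_eq_zero_iff _ (rename_injective _ Fin.rev_injective), derE_eq_zero_iff]
  refine forall_congr' fun c => ⟨fun h a => ?_, fun h a => ?_⟩
  · rw [act_lower, aeval_act_swap, h, ← aeval_act_swap, hW]
  · have h2 := h (act !![0, 1; 1, 0] a)
    rwa [act_lower, hW, aeval_act_swap, aeval_act_swap] at h2

theorem mem_invariantAlgebra_iff_der {P : MvPolynomial (Fin (n + 1)) ℂ} :
    P ∈ invariantAlgebra n ↔ derE n P = 0 ∧ derF n P = 0 := by
  rw [mem_invariantAlgebra_iff, derE_eq_zero_iff, derF_eq_zero_iff]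
  constructor
  · exact fun h => ⟨fun c => h _ (by simp [Matrix.det_fin_two]),
      fun c => h _ (by simp [Matrix.det_fin_two])⟩
  · rintro ⟨hU, hL⟩
    have key : ∀ M : Matrix (Fin 2) (Fin 2) ℂ, M.det = 1 → M 1 0 ≠ 0 →
        ∀ a, aeval (act M a) P = aeval a P := by
      intro M hM h10 a
      have hdec : M = !![1, (M 0 0 - 1) / M 1 0; 0, 1] * (!![1, 0; M 1 0, 1] *
          !![1, (M 1 1 - 1) / M 1 0; 0, 1]) := by
        rw [Matrix.det_fin_two] at hM
        ext i j
        fin_cases i <;> fin_cases j <;> simp [Matrix.mul_apply, Fin.sum_univ_two] <;> field_simp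
        · ring
        · linear_combination -hM
        · ring
      rw [hdec, ← act_act, ← act_act, hU, hL, hU]
    intro M hM a
    by_cases h10 : M 1 0 = 0
    · have h := key (!![1, 0; 1, 1] * M) (by rw [Matrix.det_mul, hM]; simp [Matrix.det_fin_two])
        (by
          rw [Matrix.det_fin_two] at hM
          simp [Matrix.mul_apply, Fin.sum_univ_two, h10] at hM ⊢
          rintro h
          simp [h] at hM)
      have hdec : M = !![1, 0; -1, 1] * (!![1, 0; 1, 1] * M) := by
        rw [← Matrix.mul_assoc]
        ext i j
        fin_cases i <;> simp [Matrix.mul_apply, Fin.sum_univ_two]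
      rw [hdec, ← act_act, h, hL]
    · exact key M hM h10 a

end Infinitesimal

section Sl2Module

variable {V : Type} [AddCommGroup V] [Module ℂ V] {e f h : Module.End ℂ V}

theorem h_apply_e_pow (hhe : ∀ x, h (e x) = e (h x) + (2 : ℂ) • e x) {v : V} {μ : ℂ}
    (hv : h v = μ • v) (k : ℕ) : h ((e ^ k) v) = (μ + 2 * k) • (e ^ k) v := by
  induction k with
  | zero => simpa using hv
  | succ k ih =>
    rw [pow_succ', Module.End.mul_apply, hhe, ih, map_smul]
    push_cast
    module

theorem h_apply_f_pow (hhf : ∀ x, h (f x) = f (h x) - (2 : ℂ) • f x) {v : V} {μ : ℂ}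
    (hv : h v = μ • v) (k : ℕ) : h ((f ^ k) v) = (μ - 2 * k) • (f ^ k) v := by
  induction k with
  | zero => simpa using hv
  | succ k ih =>
    rw [pow_succ', Module.End.mul_apply, hhf, ih, map_smul]
    push_cast
    module

theorem e_apply_f_pow_succ (hef : ∀ x, e (f x) = f (e x) + h x)
    (hhf : ∀ x, h (f x) = f (h x) - (2 : ℂ) • f x) {v : V} {μ : ℂ}
    (hv : h v = μ • v) (k : ℕ) :
    e ((f ^ (k + 1)) v) = (f ^ (k + 1)) (e v) + ((k + 1) * (μ - k)) • (f ^ k) v := by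
  induction k with
  | zero => simp [hef, hv]
  | succ k ih =>
    rw [pow_succ' f (k + 1), Module.End.mul_apply, hef, ih, h_apply_f_pow hhf hv,
      Module.End.mul_apply, map_add, map_smul, ← Module.End.mul_apply f (f ^ k), ← pow_succ']
    push_cast
    module

/-- Hilbert's operator: a truncation of the projection onto the invariants in weight zero. -/
noncomputable def hilbertOp (e f : Module.End ℂ V) (N : ℕ) : Module.End ℂ V :=
  ∑ k ∈ Finset.range N, ((-1 : ℂ) ^ k / (k.factorial * (k + 1).factorial : ℕ)) • (f ^ k * e ^ k)

theorem e_apply_hilbertOp (hef : ∀ x, e (f x) = f (e x) + h x)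
    (hhe : ∀ x, h (e x) = e (h x) + (2 : ℂ) • e x)
    (hhf : ∀ x, h (f x) = f (h x) - (2 : ℂ) • f x) {v : V} (hv : h v = 0) (N : ℕ) :
    e (hilbertOp e f (N + 1) v) =
      ((-1 : ℂ) ^ N / (N.factorial * (N + 1).factorial : ℕ)) • (f ^ N) ((e ^ (N + 1)) v) := by
  have hv' : h v = (0 : ℂ) • v := by rw [hv, zero_smul]
  induction N with
  | zero => simp [hilbertOp]
  | succ N ih =>
    rw [hilbertOp, Finset.sum_range_succ, ← hilbertOp, LinearMap.add_apply, map_add, ih,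
      LinearMap.smul_apply, Module.End.mul_apply, map_smul,
      e_apply_f_pow_succ hef hhf (h_apply_e_pow hhe hv' (N + 1)), ← Module.End.mul_apply e,
      ← pow_succ']
    have hc : (-1 : ℂ) ^ N / (N.factorial * (N + 1).factorial : ℕ) +
        (-1 : ℂ) ^ (N + 1) / ((N + 1).factorial * (N + 1 + 1).factorial : ℕ) *
          ((N + 1) * (0 + 2 * (N + 1 : ℕ) - N)) = 0 := by
      rw [Nat.factorial_succ (N + 1), Nat.factorial_succ N]
      have h1 : (N.factorial : ℂ) ≠ 0 := by exact_mod_cast N.factorial_ne_zero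
      have h2 : (N : ℂ) + 1 ≠ 0 := by exact_mod_cast N.succ_ne_zero
      have h3 : (N : ℂ) + 1 + 1 ≠ 0 := by exact_mod_cast (N + 1).succ_ne_zero
      push_cast
      field_simp
      ring
    rw [smul_add, add_left_comm, smul_smul, ← add_smul, hc, zero_smul, add_zero]

theorem h_apply_hilbertOp (hhe : ∀ x, h (e x) = e (h x) + (2 : ℂ) • e x)
    (hhf : ∀ x, h (f x) = f (h x) - (2 : ℂ) • f x) {v : V} (hv : h v = 0) (N : ℕ) :
    h (hilbertOp e f N v) = 0 := by
  have hv' : h v = (0 : ℂ) • v := by rw [hv, zero_smul]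
  simp only [hilbertOp, LinearMap.sum_apply, LinearMap.smul_apply, Module.End.mul_apply, map_sum,
    map_smul, h_apply_f_pow hhf (h_apply_e_pow hhe hv' _)]
  exact Finset.sum_eq_zero fun k _ => by module

theorem f_apply_eq_zero_of_nilpotent (hef : ∀ x, e (f x) = f (e x) + h x)
    (hhf : ∀ x, h (f x) = f (h x) - (2 : ℂ) • f x) {v : V} (hv : h v = 0) (hev : e v = 0)
    {M : ℕ} (hM : (f ^ (M + 1)) v = 0) : f v = 0 := by
  induction M with
  | zero => simpa using hM
  | succ M ih =>
    refine ih ?_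
    have h1 := e_apply_f_pow_succ hef hhf (μ := 0) (by rw [hv, zero_smul]) (v := v) (M + 1)
    rw [hM, map_zero, hev, map_zero, zero_add] at h1
    refine (smul_eq_zero.mp h1.symm).resolve_left ?_
    push_cast
    have h2 : (M : ℂ) + 1 ≠ 0 := by exact_mod_cast M.succ_ne_zero
    have h3 : (M : ℂ) + 1 + 1 ≠ 0 := by exact_mod_cast (M + 1).succ_ne_zero
    exact mul_ne_zero h3 (by rw [zero_sub]; exact neg_ne_zero.mpr h2)

end Sl2Module

section Derivations

variable {A : Type} [CommRing A] [Algebra ℂ A] (D : Derivation ℂ A A)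

theorem derivation_pow_mul_eq_zero {N M : ℕ} {p q : A} (hp : (D.toLinearMap ^ N) p = 0)
    (hq : (D.toLinearMap ^ M) q = 0) : (D.toLinearMap ^ (N + M)) (p * q) = 0 := by
  induction hs : N + M generalizing N M p q with
  | zero =>
    obtain ⟨rfl, rfl⟩ : N = 0 ∧ M = 0 := by omega
    simp at hp
    simp [hp]
  | succ s ih =>
    rw [pow_succ, Module.End.mul_apply]
    have hl : D.toLinearMap (p * q) = p * D q + q * D p := D.leibniz p q
    rw [hl, map_add]
    have h1 : (D.toLinearMap ^ s) (p * D q) = 0 := by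
      cases M with
      | zero =>
        simp at hq
        simp [hq]
      | succ M => exact ih hp (by rwa [pow_succ, Module.End.mul_apply] at hq) (by omega)
    have h2 : (D.toLinearMap ^ s) (q * D p) = 0 := by
      cases N with
      | zero =>
        simp at hp
        simp [hp]
      | succ N =>
        exact ih hq (by rwa [pow_succ, Module.End.mul_apply] at hp) (by omega)
    rw [h1, h2, add_zero]

theorem derivation_pow_mul_of_eq_zero {g : A} (hg : D g = 0) (k : ℕ) (p : A) :
    (D.toLinearMap ^ k) (g * p) = g * (D.toLinearMap ^ k) p := by
  induction k with
  | zero => simp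
  | succ k ih =>
    rw [pow_succ', Module.End.mul_apply, ih, Module.End.mul_apply]
    have := D.leibniz g ((D.toLinearMap ^ k) p)
    rw [hg, smul_zero, add_zero] at this
    exact this

theorem pow_apply_eq_zero_of_le {V : Type} [AddCommGroup V] [Module ℂ V] {e : Module.End ℂ V}
    {N M : ℕ} (h : N ≤ M) {v : V} (hv : (e ^ N) v = 0) : (e ^ M) v = 0 := by
  obtain ⟨k, rfl⟩ := Nat.exists_eq_add_of_le' h
  rw [pow_add, Module.End.mul_apply, hv, map_zero]

theorem exists_pow_apply_eq_zero_of_X {σ : Type} (D : Derivation ℂ (MvPolynomial σ ℂ) (MvPolynomial σ ℂ))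
    (hX : ∀ i, ∃ N, (D.toLinearMap ^ N) (X i) = 0) (P : MvPolynomial σ ℂ) :
    ∃ N, (D.toLinearMap ^ N) P = 0 := by
  induction P using MvPolynomial.induction_on with
  | C c => exact ⟨1, by simp⟩
  | add p q hp hq =>
    obtain ⟨N, hN⟩ := hp
    obtain ⟨M, hM⟩ := hq
    exact ⟨N + M, by rw [map_add, pow_apply_eq_zero_of_le (Nat.le_add_right N M) hN,
      pow_apply_eq_zero_of_le (Nat.le_add_left M N) hM, add_zero]⟩
  | mul_X p i hp =>
    obtain ⟨N, hN⟩ := hp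
    obtain ⟨M, hM⟩ := hX i
    exact ⟨N + M, derivation_pow_mul_eq_zero D hN hM⟩

end Derivations

section Reynolds

variable {n : ℕ}

theorem derE_extend_X {i : ℕ} (hi : i ≤ n) :
    derE n (extend X i) = (i : ℂ) • extend X (i - 1) := by
  rw [extend, dif_pos (Nat.lt_succ_iff.mpr hi), derE, mkDerivation_X]

theorem derF_extend_X (i : ℕ) :
    derF n (extend X i) = ((n : ℂ) - i) • extend X (i + 1) := by
  unfold extend
  split_ifs with h1 h2 h2
  · rw [derF, mkDerivation_X, extend, dif_pos h2]
  · rw [derF, mkDerivation_X, extend, dif_neg h2]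
  · omega
  · simp

theorem derH_extend_X (i : ℕ) :
    derH n (extend X i) = ((n : ℂ) - 2 * i) • extend X i := by
  unfold extend
  split_ifs with h1
  · rw [derH, mkDerivation_X]
  · simp

theorem derE_derF (P : MvPolynomial (Fin (n + 1)) ℂ) :
    derE n (derF n P) = derF n (derE n P) + derH n P := by
  have h : ⁅derE n, derF n⁆ = derH n := by
    refine derivation_ext fun ⟨j, hj⟩ => ?_
    have hX : (X ⟨j, hj⟩ : MvPolynomial (Fin (n + 1)) ℂ) = extend X j := by
      rw [extend, dif_pos hj]
    rw [hX, Derivation.commutator_apply, derE_extend_X (by omega), derF_extend_X, derH_extend_X,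
      Derivation.map_smul, Derivation.map_smul, derF_extend_X]
    rcases Nat.lt_or_ge n (j + 1) with h | h
    · obtain rfl : j = n := by omega
      rcases Nat.eq_zero_or_pos j with rfl | h0
      · simp
      · rw [Nat.sub_add_cancel h0, Nat.cast_sub h0]
        push_cast
        module
    · rw [derE_extend_X h, Nat.add_sub_cancel]
      rcases Nat.eq_zero_or_pos j with rfl | h0
      · simp
      · rw [Nat.sub_add_cancel h0, Nat.cast_sub h0]
        push_cast
        module
  have h2 := congrArg (fun D => D P) h
  simp only [Derivation.commutator_apply] at h2
  rw [← h2]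
  ring

theorem derH_derE (P : MvPolynomial (Fin (n + 1)) ℂ) :
    derH n (derE n P) = derE n (derH n P) + (2 : ℂ) • derE n P := by
  have h : ⁅derH n, derE n⁆ = (2 : ℂ) • derE n := by
    refine derivation_ext fun ⟨j, hj⟩ => ?_
    have hX : (X ⟨j, hj⟩ : MvPolynomial (Fin (n + 1)) ℂ) = extend X j := by
      rw [extend, dif_pos hj]
    rw [hX, Derivation.commutator_apply, Derivation.smul_apply, derE_extend_X (by omega),
      derH_extend_X, Derivation.map_smul, Derivation.map_smul, derH_extend_X,
      derE_extend_X (by omega)]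
    rcases Nat.eq_zero_or_pos j with rfl | h0
    · simp
    · rw [Nat.cast_sub h0]
      push_cast
      module
  have h2 := congrArg (fun D => D P) h
  simp only [Derivation.commutator_apply, Derivation.smul_apply] at h2
  rw [← h2]
  ring

theorem derH_derF (P : MvPolynomial (Fin (n + 1)) ℂ) :
    derH n (derF n P) = derF n (derH n P) - (2 : ℂ) • derF n P := by
  have h : ⁅derH n, derF n⁆ = (-2 : ℂ) • derF n := by
    refine derivation_ext fun ⟨j, hj⟩ => ?_
    have hX : (X ⟨j, hj⟩ : MvPolynomial (Fin (n + 1)) ℂ) = extend X j := by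
      rw [extend, dif_pos hj]
    rw [hX, Derivation.commutator_apply, Derivation.smul_apply, derF_extend_X,
      derH_extend_X, Derivation.map_smul, Derivation.map_smul, derH_extend_X, derF_extend_X]
    push_cast
    module
  have h2 := congrArg (fun D => D P) h
  simp only [Derivation.commutator_apply, Derivation.smul_apply] at h2
  rw [sub_eq_iff_eq_add.mp h2]
  module

theorem derE_nilpotent (P : MvPolynomial (Fin (n + 1)) ℂ) :
    ∃ N, ((derE n).toLinearMap ^ N) P = 0 := by
  refine exists_pow_apply_eq_zero_of_X _ (fun ⟨j, hj⟩ => ⟨j + 1, ?_⟩) P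
  have hX : (X ⟨j, hj⟩ : MvPolynomial (Fin (n + 1)) ℂ) = extend X j := by
    rw [extend, dif_pos hj]
  rw [hX]
  clear hX
  induction j with
  | zero =>
    have := derE_extend_X (n := n) (i := 0) (by omega)
    simpa using this
  | succ j ih =>
    rw [pow_succ, Module.End.mul_apply]
    have h : (derE n).toLinearMap (extend X (j + 1)) = ((j + 1 : ℕ) : ℂ) • extend X j :=
      derE_extend_X (by omega)
    rw [h, map_smul, ih (by omega), smul_zero]

theorem derF_nilpotent (P : MvPolynomial (Fin (n + 1)) ℂ) :
    ∃ N, ((derF n).toLinearMap ^ N) P = 0 := by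
  obtain ⟨N, hN⟩ := derE_nilpotent (rename Fin.rev P)
  refine ⟨N, ?_⟩
  have key : ∀ k, ((derF n).toLinearMap ^ k) P =
      rename Fin.rev (((derE n).toLinearMap ^ k) (rename Fin.rev P)) := fun k => by
    induction k with
    | zero => simp [rename_rename, Fin.rev_involutive.comp_self]
    | succ k ih =>
      rw [pow_succ', pow_succ', Module.End.mul_apply, Module.End.mul_apply, ih]
      refine (derF_eq_rename _).trans ?_
      rw [rename_rename, Fin.rev_involutive.comp_self, rename_id_apply]
      rfl
  rw [key, hN, map_zero]

/-- The torus weights of the coefficients of a binary form. -/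
def torusWeight (n : ℕ) (j : Fin (n + 1)) : ℤ := n - 2 * (j : ℕ)

theorem derH_monomial (s : Fin (n + 1) →₀ ℕ) (c : ℂ) :
    derH n (monomial s c) = ((Finsupp.weight (torusWeight n) s : ℤ) : ℂ) • monomial s c := by
  induction s using Finsupp.induction_linear generalizing c with
  | zero => simp
  | add s t hs ht =>
    have h : monomial (s + t) c = monomial s c * monomial t (1 : ℂ) := by
      rw [monomial_mul, mul_one]
    rw [h, Derivation.leibniz, hs, ht, map_add, smul_eq_mul, smul_eq_mul]
    push_cast
    rw [add_smul, mul_smul_comm, mul_smul_comm, mul_comm (monomial t _)]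
    exact add_comm _ _
  | single j k =>
    rw [← mul_one c, ← C_mul_monomial, ← X_pow_eq_monomial, Derivation.leibniz,
      Derivation.leibniz_pow, derH, MvPolynomial.derivation_C, mkDerivation_X,
      Finsupp.weight_single]
    cases k with
    | zero => simp
    | succ k =>
      rw [Nat.add_sub_cancel, smul_zero, add_zero, pow_succ, torusWeight]
      simp only [smul_eq_mul, smul_eq_C_mul, nsmul_eq_mul]
      push_cast
      simp only [map_mul, map_sub, map_add, map_natCast, map_one, map_ofNat]
      ring

theorem coeff_derH (P : MvPolynomial (Fin (n + 1)) ℂ) (s : Fin (n + 1) →₀ ℕ) :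
    coeff s (derH n P) = ((Finsupp.weight (torusWeight n) s : ℤ) : ℂ) * coeff s P := by
  induction P using MvPolynomial.induction_on' with
  | monomial t c =>
    rw [derH_monomial, coeff_smul, coeff_monomial]
    split_ifs with h
    · rw [h, smul_eq_mul]
    · simp
  | add p q hp hq => rw [map_add, coeff_add, hp, hq, coeff_add, mul_add]

theorem derH_eq_zero_iff (P : MvPolynomial (Fin (n + 1)) ℂ) :
    derH n P = 0 ↔ IsWeightedHomogeneous (torusWeight n) P 0 := by
  constructor
  · intro h s hs
    have := coeff_derH P s
    rw [h, coeff_zero] at this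
    exact_mod_cast (mul_eq_zero.mp this.symm).resolve_right hs
  · intro h
    ext s
    rw [coeff_derH, coeff_zero]
    by_cases hs : coeff s P = 0
    · rw [hs, mul_zero]
    · rw [h hs, Int.cast_zero, zero_mul]

theorem isWeightedHomogeneous_of_mem_invariantAlgebra {P : MvPolynomial (Fin (n + 1)) ℂ}
    (hP : P ∈ invariantAlgebra n) : IsWeightedHomogeneous (torusWeight n) P 0 := by
  obtain ⟨hE, hF⟩ := mem_invariantAlgebra_iff_der.mp hP
  rw [← derH_eq_zero_iff]
  have := derE_derF P
  rwa [hE, hF, map_zero, map_zero, zero_add, eq_comm] at this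

theorem weightedHomogeneousComponent_mul_left {σ M : Type} [AddCancelCommMonoid M]
    {w : σ → M} {m : M} {g : MvPolynomial σ ℂ} (hg : IsWeightedHomogeneous w g m) (j : M)
    (p : MvPolynomial σ ℂ) :
    weightedHomogeneousComponent w (m + j) (g * p) = g * weightedHomogeneousComponent w j p := by
  classical
  induction p using MvPolynomial.induction_on' with
  | monomial t c =>
    have ht := isWeightedHomogeneous_monomial w t c rfl
    rw [weightedHomogeneousComponent_of_mem (hg.mul ht), weightedHomogeneousComponent_of_mem ht]
    simp only [add_right_inj, mul_ite, mul_zero]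
  | add p q hp hq => rw [mul_add, map_add, hp, hq, map_add, mul_add]

/-- Hilbert's operator truncated at step `N + 1`, on the weight-zero part. -/
noncomputable def reynolds (n N : ℕ) : Module.End ℂ (MvPolynomial (Fin (n + 1)) ℂ) :=
  hilbertOp (derE n).toLinearMap (derF n).toLinearMap (N + 1) *
    weightedHomogeneousComponent (torusWeight n) 0

theorem reynolds_mem {N : ℕ} {P : MvPolynomial (Fin (n + 1)) ℂ}
    (hN : ((derE n).toLinearMap ^ (N + 1)) (weightedHomogeneousComponent (torusWeight n) 0 P) = 0) :
    reynolds n N P ∈ invariantAlgebra n := by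
  have hH : derH n (weightedHomogeneousComponent (torusWeight n) 0 P) = 0 :=
    (derH_eq_zero_iff _).mpr (weightedHomogeneousComponent_isWeightedHomogeneous _ _)
  have h1 := e_apply_hilbertOp (e := (derE n).toLinearMap) (f := (derF n).toLinearMap)
    (h := (derH n).toLinearMap) derE_derF derH_derE derH_derF hH N
  rw [hN, map_zero, smul_zero] at h1
  have h2 := h_apply_hilbertOp (e := (derE n).toLinearMap) (f := (derF n).toLinearMap)
    (h := (derH n).toLinearMap) derH_derE derH_derF hH (N + 1)
  obtain ⟨M, hM⟩ := derF_nilpotent (reynolds n N P)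
  exact mem_invariantAlgebra_iff_der.mpr ⟨h1, f_apply_eq_zero_of_nilpotent
    (e := (derE n).toLinearMap) (f := (derF n).toLinearMap)
    (h := (derH n).toLinearMap) derE_derF derH_derF h2 h1
    (pow_apply_eq_zero_of_le (Nat.le_succ M) hM)⟩

theorem reynolds_mul {g : MvPolynomial (Fin (n + 1)) ℂ} (hg : g ∈ invariantAlgebra n) (N : ℕ)
    (P : MvPolynomial (Fin (n + 1)) ℂ) : reynolds n N (g * P) = g * reynolds n N P := by
  have h0 := weightedHomogeneousComponent_mul_left
    (isWeightedHomogeneous_of_mem_invariantAlgebra hg) 0 P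
  rw [add_zero] at h0
  obtain ⟨hE, hF⟩ := mem_invariantAlgebra_iff_der.mp hg
  simp only [reynolds, Module.End.mul_apply, h0, hilbertOp, LinearMap.sum_apply,
    LinearMap.smul_apply, Finset.mul_sum, mul_smul_comm,
    derivation_pow_mul_of_eq_zero _ hE, derivation_pow_mul_of_eq_zero _ hF]

theorem reynolds_one (N : ℕ) : reynolds n N 1 = 1 := by
  have h1 : weightedHomogeneousComponent (torusWeight n) 0 (1 : MvPolynomial (Fin (n + 1)) ℂ) = 1 :=
    (isWeightedHomogeneous_one ℂ _).weightedHomogeneousComponent_same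
  rw [reynolds, Module.End.mul_apply, h1, hilbertOp, Finset.sum_range_succ', LinearMap.add_apply,
    LinearMap.sum_apply, Finset.sum_eq_zero, zero_add]
  · simp
  · intro k _
    have hE : (derE n).toLinearMap 1 = 0 := (derE n).map_one_eq_zero
    rw [LinearMap.smul_apply, Module.End.mul_apply, pow_succ (derE n).toLinearMap,
      Module.End.mul_apply, hE, map_zero, map_zero, smul_zero]

theorem reynolds_of_mem {g : MvPolynomial (Fin (n + 1)) ℂ} (hg : g ∈ invariantAlgebra n) (N : ℕ) :
    reynolds n N g = g := by
  have h := reynolds_mul hg N 1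
  rwa [reynolds_one, mul_one] at h

/-- An invariant in the ideal generated by invariants is a combination with invariant
coefficients. -/
theorem exists_invariant_coefficients {ι : Type} (s : Finset ι)
    {g h : ι → MvPolynomial (Fin (n + 1)) ℂ} (hg : ∀ i ∈ s, g i ∈ invariantAlgebra n)
    (hx : ∑ i ∈ s, g i * h i ∈ invariantAlgebra n) :
    ∃ h' : ι → MvPolynomial (Fin (n + 1)) ℂ, (∀ i ∈ s, h' i ∈ invariantAlgebra n) ∧
      ∑ i ∈ s, g i * h i = ∑ i ∈ s, g i * h' i := by
  choose N hN using fun i =>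
    derE_nilpotent (weightedHomogeneousComponent (torusWeight n) 0 (h i))
  refine ⟨fun i => reynolds n (s.sup N) (h i), fun i hi => reynolds_mem ?_, ?_⟩
  · exact pow_apply_eq_zero_of_le ((Finset.le_sup hi).trans (Nat.le_succ _)) (hN i)
  · rw [← reynolds_of_mem hx (s.sup N), map_sum]
    exact Finset.sum_congr rfl fun i hi => reynolds_mul (hg i hi) _ _

end Reynolds

section FiniteGeneration

theorem isHomogeneous_mkDerivation_monomial {σ : Type} {f : σ → MvPolynomial σ ℂ}
    (hf : ∀ i, (f i).IsHomogeneous 1) (s : σ →₀ ℕ) (c : ℂ) :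
    (mkDerivation ℂ f (monomial s c)).IsHomogeneous s.degree := by
  rw [mkDerivation_monomial, smul_eq_C_mul, Finsupp.sum]
  refine IsHomogeneous.C_mul (IsHomogeneous.sum _ _ _ fun i hi => ?_) c
  have h1 : (Finsupp.single i 1 : σ →₀ ℕ) ≤ s := by
    rw [Finsupp.single_le_iff]
    exact Nat.one_le_iff_ne_zero.mpr (Finsupp.mem_support_iff.mp hi)
  have h2 : s.degree = (s - Finsupp.single i 1).degree + 1 := by
    conv_lhs => rw [← tsub_add_cancel_of_le h1]
    rw [map_add, Finsupp.degree_single]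
  rw [h2, smul_eq_mul]
  exact (isHomogeneous_monomial _ rfl).mul (hf i)

theorem homogeneousComponent_mkDerivation {σ : Type} {f : σ → MvPolynomial σ ℂ}
    (hf : ∀ i, (f i).IsHomogeneous 1) (d : ℕ) (P : MvPolynomial σ ℂ) :
    homogeneousComponent d (mkDerivation ℂ f P) =
      mkDerivation ℂ f (homogeneousComponent d P) := by
  induction P using MvPolynomial.induction_on' with
  | monomial s c =>
    rw [homogeneousComponent_of_mem (isHomogeneous_mkDerivation_monomial hf s c),
      homogeneousComponent_of_mem (isHomogeneous_monomial c rfl)]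
    split_ifs
    · rfl
    · rw [map_zero]
  | add p q hp hq => simp only [map_add, hp, hq]

variable {n : ℕ}

theorem homogeneousComponent_mem_invariantAlgebra {P : MvPolynomial (Fin (n + 1)) ℂ}
    (hP : P ∈ invariantAlgebra n) (d : ℕ) : homogeneousComponent d P ∈ invariantAlgebra n := by
  rw [mem_invariantAlgebra_iff_der] at hP ⊢
  constructor
  · rw [derE, ← homogeneousComponent_mkDerivation, ← derE, hP.1, map_zero]
    intro i
    rw [smul_eq_C_mul]
    exact (isHomogeneous_extend_X _ _).C_mul _
  · rw [derF, ← homogeneousComponent_mkDerivation, ← derF, hP.2, map_zero]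
    intro i
    rw [smul_eq_C_mul]
    exact (isHomogeneous_extend_X _ _).C_mul _

variable (n) in
/-- The homogeneous invariants of positive degree. -/
def positiveInvariants : Set (MvPolynomial (Fin (n + 1)) ℂ) :=
  {P | P ∈ invariantAlgebra n ∧ ∃ d, 0 < d ∧ P.IsHomogeneous d}

theorem sub_constant_mem_span {P : MvPolynomial (Fin (n + 1)) ℂ} (hP : P ∈ invariantAlgebra n) :
    P - C (coeff 0 P) ∈ Ideal.span (positiveInvariants n) := by
  have h : P - C (coeff 0 P) =
      ∑ i ∈ Finset.range P.totalDegree, homogeneousComponent (i + 1) P := by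
    rw [sub_eq_iff_eq_add, ← homogeneousComponent_zero,
      ← Finset.sum_range_succ' (fun i => homogeneousComponent i P), sum_homogeneousComponent]
  rw [h]
  exact Ideal.sum_mem _ fun i _ => Ideal.subset_span
    ⟨homogeneousComponent_mem_invariantAlgebra hP _, i + 1, i.succ_pos,
      homogeneousComponent_isHomogeneous _ _⟩

theorem mul_mem_span_adjoin {σ : Type} {V S : Set (MvPolynomial σ ℂ)} {p q : MvPolynomial σ ℂ}
    (hp : p ∈ V) (hq : q ∈ Submodule.span (Algebra.adjoin ℂ V) S) :
    p * q ∈ Submodule.span (Algebra.adjoin ℂ V) S :=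
  Submodule.smul_mem _ (⟨p, Algebra.subset_adjoin hp⟩ : Algebra.adjoin ℂ V) hq

theorem mem_span_of_sub_mem {r : ℕ} {v : Fin r → MvPolynomial (Fin (n + 1)) ℂ} {e : Fin r → ℕ}
    (hv : ∀ i, v i ∈ invariantAlgebra n) (he : ∀ i, (v i).IsHomogeneous (e i))
    (hpos : ∀ i, 0 < e i) {S : Finset (MvPolynomial (Fin (n + 1)) ℂ)}
    (hSA : ∀ s ∈ S, s ∈ invariantAlgebra n) (hSh : ∀ s ∈ S, ∃ d, s.IsHomogeneous d)
    (hS : ∀ x ∈ invariantAlgebra n, ∃ s ∈ Submodule.span ℂ (S : Set _),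
      x - s ∈ Ideal.span (Set.range v)) {x : MvPolynomial (Fin (n + 1)) ℂ}
    (hx : x ∈ invariantAlgebra n) :
    x ∈ Submodule.span (Algebra.adjoin ℂ (Set.range v)) (S : Set _) := by
  have hom : ∀ d, ∀ x ∈ invariantAlgebra n, x.IsHomogeneous d →
      x ∈ Submodule.span (Algebra.adjoin ℂ (Set.range v)) (S : Set _) := by
    intro d
    induction d using Nat.strong_induction_on with
    | _ d ih =>
    intro x hx hxd
    obtain ⟨s, hs, hxs⟩ := hS x hx
    obtain ⟨c, hc⟩ := Ideal.mem_span_range_iff_exists_fun.mp hxs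
    have hsA : s ∈ invariantAlgebra n :=
      (Submodule.span_le (p := Subalgebra.toSubmodule (invariantAlgebra n))).mpr hSA hs
    have hc' : ∑ i, v i * c i = x - s := by
      rw [← hc]
      exact Finset.sum_congr rfl fun i _ => mul_comm _ _
    obtain ⟨y, hyA, hy⟩ := exists_invariant_coefficients Finset.univ
      (fun i _ => hv i) (h := c) (hc'.symm ▸ Subalgebra.sub_mem _ hx hsA)
    rw [hc'] at hy
    have hxe : x = homogeneousComponent d s + ∑ i, homogeneousComponent d (v i * y i) := by
      rw [← map_sum, ← hy, map_sub, add_sub_cancel, homogeneousComponent_of_mem hxd, if_pos rfl]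
    rw [hxe]
    refine Submodule.add_mem _ ?_ (Submodule.sum_mem _ fun i _ => ?_)
    · have h1 : homogeneousComponent d s ∈ Submodule.span ℂ (S : Set _) := by
        clear hxs hc hsA hc' hy hxe
        induction hs using Submodule.span_induction with
        | mem s hs =>
          obtain ⟨d', hd'⟩ := hSh s hs
          rw [homogeneousComponent_of_mem hd']
          split_ifs
          · exact Submodule.subset_span hs
          · exact Submodule.zero_mem _
        | zero => rw [map_zero]; exact Submodule.zero_mem _
        | add _ _ _ _ h1 h2 => rw [map_add]; exact Submodule.add_mem _ h1 h2
        | smul a _ _ h1 => rw [map_smul]; exact Submodule.smul_mem _ _ h1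
      exact Submodule.span_le_restrictScalars ℂ _ _ h1
    · by_cases hle : e i ≤ d
      · obtain ⟨j, rfl⟩ := Nat.exists_eq_add_of_le hle
        have h2 := weightedHomogeneousComponent_mul_left (he i) j (y i)
        have h3 := mul_mem_span_adjoin (Set.mem_range_self i) (ih j (by have := hpos i; omega) _
            (homogeneousComponent_mem_invariantAlgebra (hyA i (Finset.mem_univ i)) j)
            (homogeneousComponent_isHomogeneous j (y i)))
        rw [homogeneousComponent, h2]
        exact h3
      · have h0 : homogeneousComponent d (v i * y i) = 0 := by
          rw [← sum_homogeneousComponent (y i), Finset.mul_sum, map_sum]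
          refine Finset.sum_eq_zero fun j _ => ?_
          rw [homogeneousComponent_of_mem
            ((he i).mul (homogeneousComponent_isHomogeneous j (y i))), if_neg (by omega)]
        rw [h0]
        exact Submodule.zero_mem _
  rw [← sum_homogeneousComponent x]
  exact Submodule.sum_mem _ fun d _ => hom d _ (homogeneousComponent_mem_invariantAlgebra hx d)
    (homogeneousComponent_isHomogeneous d x)

theorem exists_finset_sub_mem_pow (m : ℕ) :
    ∃ S : Finset (MvPolynomial (Fin (n + 1)) ℂ), (∀ s ∈ S, s ∈ invariantAlgebra n) ∧
      (∀ s ∈ S, ∃ d, s.IsHomogeneous d) ∧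
      ∀ x ∈ invariantAlgebra n, ∃ s ∈ Submodule.span ℂ (S : Set _),
        x - s ∈ Ideal.span (positiveInvariants n) ^ m := by
  classical
  induction m with
  | zero => exact ⟨∅, by simp, by simp, fun x _ => ⟨0, Submodule.zero_mem _, by simp⟩⟩
  | succ m ih =>
    obtain ⟨S, hSA, hSh, hS⟩ := ih
    obtain ⟨G, hG, hGI⟩ := (Submodule.fg_span_iff_fg_span_finset_subset (positiveInvariants n)).mp
      (IsNoetherian.noetherian (Ideal.span (positiveInvariants n)))
    refine ⟨insert 1 (Finset.image₂ (· * ·) G S), ?_, ?_, fun x hx => ?_⟩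
    · intro s hs
      rcases Finset.mem_insert.mp hs with rfl | hs
      · exact Subalgebra.one_mem _
      · obtain ⟨p, hp, q, hq, rfl⟩ := Finset.mem_image₂.mp hs
        exact Subalgebra.mul_mem _ (hG hp).1 (hSA q hq)
    · intro s hs
      rcases Finset.mem_insert.mp hs with rfl | hs
      · exact ⟨0, isHomogeneous_one _ _⟩
      · obtain ⟨p, hp, q, hq, rfl⟩ := Finset.mem_image₂.mp hs
        obtain ⟨-, d, -, hd⟩ := hG hp
        obtain ⟨e, he⟩ := hSh q hq
        exact ⟨d + e, hd.mul he⟩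
    · have h1 := sub_constant_mem_span hx
      have h1A : x - C (coeff 0 x) ∈ invariantAlgebra n :=
        Subalgebra.sub_mem _ hx (Subalgebra.algebraMap_mem _ _)
      have h2 : x - C (coeff 0 x) ∈ Submodule.span (MvPolynomial (Fin (n + 1)) ℂ) (G : Set _) :=
        hGI ▸ h1
      obtain ⟨f, -, hf⟩ := Submodule.mem_span_finset.mp h2
      have hf' : ∑ p ∈ G, p * f p = x - C (coeff 0 x) := by
        rw [← hf]
        exact Finset.sum_congr rfl fun p _ => mul_comm _ _
      obtain ⟨y, hyA, hy⟩ := exists_invariant_coefficients G (g := fun p => p)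
        (fun p hp => (hG hp).1) (h := f) (hf'.symm ▸ h1A)
      rw [hf'] at hy
      choose! t ht hyt using fun p hp => hS (y p) (hyA p hp)
      refine ⟨C (coeff 0 x) + ∑ p ∈ G, p * t p, ?_, ?_⟩
      · refine Submodule.add_mem _ ?_ (Submodule.sum_mem _ fun p hp => ?_)
        · rw [← mul_one (C _), ← smul_eq_C_mul]
          exact Submodule.smul_mem _ _ (Submodule.subset_span (by simp))
        · have hmap : (S : Set (MvPolynomial (Fin (n + 1)) ℂ)) ⊆
              (Submodule.span ℂ ((insert 1 (Finset.image₂ (· * ·) G S) : Finset _) :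
                Set (MvPolynomial (Fin (n + 1)) ℂ))).comap (LinearMap.mulLeft ℂ p) := by
            intro q hq
            refine Submodule.subset_span ?_
            exact Finset.mem_insert_of_mem (Finset.mem_image₂_of_mem hp hq)
          exact Submodule.span_le.mpr hmap (ht p hp)
      · have h3 : x - (C (coeff 0 x) + ∑ p ∈ G, p * t p) = ∑ p ∈ G, p * (y p - t p) := by
          simp only [mul_sub, Finset.sum_sub_distrib]
          rw [← hy]
          ring
        rw [h3, pow_succ']
        exact Ideal.sum_mem _ fun p hp =>
          Ideal.mul_mem_mul (Ideal.subset_span (hG hp)) (hyt p hp)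

/-- Hilbert's criterion: homogeneous invariants whose common zeros lie in the nullcone
generate a subalgebra over which the algebra of invariants is finite. -/
theorem exists_finset_span_adjoin {r : ℕ} {v : Fin r → MvPolynomial (Fin (n + 1)) ℂ}
    {e : Fin r → ℕ} (hv : ∀ i, v i ∈ invariantAlgebra n) (he : ∀ i, (v i).IsHomogeneous (e i))
    (hpos : ∀ i, 0 < e i)
    (hnull : ∀ a : Fin (n + 1) → ℂ, (∀ i, aeval a (v i) = 0) →
      ∀ P ∈ positiveInvariants n, aeval a P = 0) :
    ∃ F : Finset (MvPolynomial (Fin (n + 1)) ℂ),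
      (F : Set (MvPolynomial (Fin (n + 1)) ℂ)) ⊆ invariantAlgebra n ∧
      ∀ x ∈ invariantAlgebra n,
        x ∈ Submodule.span (Algebra.adjoin ℂ (Set.range v)) (F : Set _) := by
  have hrad : Ideal.span (positiveInvariants n) ≤ (Ideal.span (Set.range v)).radical := by
    rw [← vanishingIdeal_zeroLocus_eq_radical (K := ℂ), Ideal.span_le]
    intro P hP
    refine mem_vanishingIdeal_iff.mpr fun a ha => hnull a (fun i => ?_) P hP
    exact mem_zeroLocus_iff.mp ha _ (Ideal.subset_span ⟨i, rfl⟩)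
  obtain ⟨m, hm⟩ := Ideal.exists_pow_le_of_le_radical_of_fg hrad (IsNoetherian.noetherian _)
  obtain ⟨S, hSA, hSh, hS⟩ := exists_finset_sub_mem_pow (n := n) m
  refine ⟨S, hSA, fun x hx => mem_span_of_sub_mem hv he hpos hSA hSh (fun y hy => ?_) hx⟩
  obtain ⟨s, hs, hys⟩ := hS y hy
  exact ⟨s, hs, hm hys⟩

end FiniteGeneration

section Moves

variable {n : ℕ}

theorem act_scalar (c : ℂ) (a : Fin (n + 1) → ℂ) : act !![c, 0; 0, c] a = c ^ n • a := by
  have h : linSubst !![c, 0; 0, c] (formOf n a) = formOf n (c ^ n • a) := by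
    have h0 : linSubst !![c, 0; 0, c] (X 0) = C c * X 0 := by
      simp [linSubst, Fin.sum_univ_two, smul_eq_C_mul]
    have h1 : linSubst !![c, 0; 0, c] (X 1) = C c * X 1 := by
      simp [linSubst, Fin.sum_univ_two, smul_eq_C_mul]
    have hC : ∀ z : ℂ, linSubst !![c, 0; 0, c] (C z) = C z := fun z => by
      simp [linSubst]
    simp only [formOf, map_sum]
    refine Finset.sum_congr rfl fun i _ => ?_
    rw [map_mul, map_mul, map_pow, map_pow, h0, h1, hC, Pi.smul_apply, smul_eq_mul]
    have hi : c ^ n = c ^ (n - (i : ℕ)) * c ^ (i : ℕ) := by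
      rw [← pow_add, Nat.sub_add_cancel (Nat.lt_succ_iff.mp i.2)]
    rw [hi]
    simp only [map_mul, map_pow]
    ring
  rw [act, h, coeffOf_formOf]

theorem act_rev (a : Fin (n + 1) → ℂ) :
    act !![0, Complex.I; Complex.I, 0] a = Complex.I ^ n • fun j => a j.rev := by
  have h : (!![0, Complex.I; Complex.I, 0] : Matrix (Fin 2) (Fin 2) ℂ) =
      !![0, 1; 1, 0] * !![Complex.I, 0; 0, Complex.I] := by
    ext i j
    fin_cases i <;> fin_cases j <;> simp [Matrix.mul_apply, Fin.sum_univ_two]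
  rw [h, ← act_act, act_swap, act_scalar]

theorem det_upper (c : ℂ) : (!![1, c; 0, 1] : Matrix (Fin 2) (Fin 2) ℂ).det = 1 := by
  simp [Matrix.det_fin_two]

theorem det_rev : (!![0, Complex.I; Complex.I, 0] : Matrix (Fin 2) (Fin 2) ℂ).det = 1 := by
  simp [Matrix.det_fin_two]

theorem extend_act_upper (c : ℂ) (a : Fin (n + 1) → ℂ) {j : ℕ} (hj : j ≤ n) :
    extend (act !![1, c; 0, 1] a) j =
      ∑ i ∈ Finset.range (j + 1), (j.choose i : ℂ) * c ^ (j - i) * extend a i := by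
  rw [extend, dif_pos (Nat.lt_succ_iff.mpr hj), act_upper]

/-- A binary form has a root, which can be moved to infinity. -/
theorem exists_act_zero_eq_zero (hn : 0 < n) (a : Fin (n + 1) → ℂ) :
    ∃ M : Matrix (Fin 2) (Fin 2) ℂ, M.det = 1 ∧ extend (act M a) 0 = 0 := by
  by_cases h0 : extend a 0 = 0
  · refine ⟨!![1, 0; 0, 1], det_upper 0, ?_⟩
    rwa [act_upper_zero]
  · let p : Polynomial ℂ := ∑ i ∈ Finset.range (n + 1),
      Polynomial.C ((n.choose i : ℂ) * extend a i) * Polynomial.X ^ (n - i)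
    have hp : p.coeff n = extend a 0 := by
      simp only [p, Polynomial.finsetSum_coeff, Polynomial.coeff_C_mul_X_pow]
      rw [Finset.sum_eq_single 0]
      · simp
      · intro i hi hi0
        rw [if_neg]
        have := Finset.mem_range.mp hi
        omega
      · simp
    have hdeg : p.degree ≠ 0 := fun h => by
      rw [Polynomial.eq_C_of_degree_eq_zero h, Polynomial.coeff_C, if_neg hn.ne'] at hp
      exact h0 hp.symm
    obtain ⟨c, hc⟩ := IsAlgClosed.exists_root p hdeg
    refine ⟨!![1, c; 0, 1] * !![0, Complex.I; Complex.I, 0], ?_, ?_⟩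
    · rw [Matrix.det_mul, det_upper, det_rev, one_mul]
    · have h := extend_act_upper c a le_rfl
      have h2 : ∑ i ∈ Finset.range (n + 1), (n.choose i : ℂ) * c ^ (n - i) * extend a i = 0 := by
        rw [← hc.eq_zero]
        simp only [p, Polynomial.eval_finsetSum, Polynomial.eval_mul, Polynomial.eval_C,
          Polynomial.eval_pow, Polynomial.eval_X]
        exact Finset.sum_congr rfl fun i _ => by ring
      rw [h2] at h
      rw [← act_act, act_rev, extend, dif_pos n.succ_pos, Pi.smul_apply]
      rw [extend, dif_pos n.lt_succ_self] at h
      have h3 : Fin.rev (⟨0, n.succ_pos⟩ : Fin (n + 1)) = ⟨n, n.lt_succ_self⟩ := by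
        ext
        simp
      rw [h3, h, smul_zero]

end Moves

section Nullcone

/-- The octavics in the nullcone. -/
def IsNull (a : Fin 9 → ℂ) : Prop := ∀ P ∈ positiveInvariants 8, aeval a P = 0

theorem isNull_act {M : Matrix (Fin 2) (Fin 2) ℂ} (hM : M.det = 1) {a : Fin 9 → ℂ} :
    IsNull (act M a) ↔ IsNull a :=
  forall₂_congr fun _ hP => by rw [mem_invariantAlgebra_iff.mp hP.1 M hM a]

theorem isNull_of_forall_le {a : Fin 9 → ℂ} (h : ∀ j ≤ 4, extend a j = 0) : IsNull a := by
  rintro P ⟨hP, d, hd, hPd⟩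
  rw [aeval_eq_eval, eval_eq]
  refine Finset.sum_eq_zero fun s hs => ?_
  have hs' := mem_support_iff.mp hs
  have hw := isWeightedHomogeneous_of_mem_invariantAlgebra hP hs'
  have hdeg := hPd hs'
  obtain ⟨j, hj4, hj⟩ : ∃ j : Fin 9, (j : ℕ) ≤ 4 ∧ s j ≠ 0 := by
    by_contra! hcon
    rw [Finsupp.weight_apply, Finsupp.sum_fintype _ _ (by simp)] at hw hdeg
    simp only [Fin.sum_univ_succ, torusWeight] at hw hdeg
    have e0 := hcon 0 (by simp)
    have e1 := hcon 1 (by simp)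
    have e2 := hcon 2 (by simp)
    have e3 := hcon 3 (by simp)
    have e4 := hcon 4 (by simp)
    simp at hw hdeg
    omega
  have haj : a j = 0 := by
    have := h j hj4
    rwa [extend_coe] at this
  rw [Finset.prod_eq_zero (Finsupp.mem_support_iff.mpr hj) (by rw [haj, zero_pow hj]), mul_zero]

theorem isNull_of_forall_ge {a : Fin 9 → ℂ} (h : ∀ j, 4 ≤ j → j ≤ 8 → extend a j = 0) :
    IsNull a := by
  rw [← isNull_act det_rev]
  refine isNull_of_forall_le fun j hj => ?_
  have h2 := h (8 - j) (by omega) (by omega)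
  rw [extend, dif_pos (by omega)] at h2 ⊢
  rw [act_rev, Pi.smul_apply]
  have h3 : Fin.rev (⟨j, by omega⟩ : Fin 9) = ⟨8 - j, by omega⟩ := by
    ext
    simp
  rw [h3, h2, smul_zero]

end Nullcone

section NullconeOctavic

theorem extend_kCoeff (b : ℕ → ℂ) {j : ℕ} (hj : j ≤ 4) :
    extend (fun i : Fin 5 => kCoeff b i) j = kCoeff b j := by
  rw [extend, dif_pos (Nat.lt_succ_iff.mpr hj)]

theorem kCoeff_act_eq {M : Matrix (Fin 2) (Fin 2) ℂ} (hM : M.det = 1) (a : Fin 9 → ℂ) {j : ℕ}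
    (hj : j ≤ 4) : kCoeff (extend (act M a)) j =
      extend (act M fun i : Fin 5 => kCoeff (extend a) i) j := by
  rw [← kCoeff_act hM, extend_kCoeff _ hj]

theorem kCoeff_act_upper (c : ℂ) (a : Fin 9 → ℂ) {j : ℕ} (hj : j ≤ 4) :
    kCoeff (extend (act !![1, c; 0, 1] a)) j =
      ∑ i ∈ Finset.range (j + 1), (j.choose i : ℂ) * c ^ (j - i) * kCoeff (extend a) i := by
  rw [kCoeff_act_eq (det_upper c) a hj, extend_act_upper c _ hj]
  refine Finset.sum_congr rfl fun i hi => ?_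
  rw [extend_kCoeff _ (by have := Finset.mem_range.mp hi; omega)]

theorem kCoeff_act_rev (a : Fin 9 → ℂ) {j : ℕ} (hj : j ≤ 4) :
    kCoeff (extend (act !![0, Complex.I; Complex.I, 0] a)) j = kCoeff (extend a) (4 - j) := by
  rw [kCoeff_act_eq det_rev a hj, act_rev, extend, dif_pos (by omega), Pi.smul_apply,
    Complex.I_pow_four, one_smul, Fin.val_rev]
  congr 1
  dsimp only
  omega

/-- Octavics with a root at infinity whose covariant `k` is a multiple of `y⁴`. -/
theorem isNull_of_kCoeff_eq_zero {a : Fin 9 → ℂ} (h0 : extend a 0 = 0)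
    (hk : ∀ j < 4, kCoeff (extend a) j = 0) (hI : octInv (extend a) = 0) : IsNull a := by
  have shift : ∀ c : ℂ, extend (act !![1, c; 0, 1] a) 0 = 0 ∧
      (∀ j < 4, kCoeff (extend (act !![1, c; 0, 1] a)) j = 0) ∧
      octInv (extend (act !![1, c; 0, 1] a)) = 0 := fun c => by
    refine ⟨by rw [extend_act_upper c a (by omega)]; simp [h0], fun j hj => ?_, ?_⟩
    · rw [kCoeff_act_upper c a hj.le]
      refine Finset.sum_eq_zero fun i hi => ?_
      rw [hk i (by have := Finset.mem_range.mp hi; omega), mul_zero]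
    · rw [octInv_act (det_upper c), hI]
  by_cases h1 : extend a 1 = 0
  · by_cases h2 : extend a 2 = 0
    · have k2 := hk 2 (by omega)
      have k0 := hk 0 (by omega)
      rw [kCoeff_two, smul_eq_mul] at k2
      rw [kCoeff_zero] at k0
      have h3 : extend a 3 = 0 := by
        simpa [h0, h1, h2] using k0
      have h4 : extend a 4 = 0 := by
        simpa [h0, h1, h2, h3] using k2
      refine isNull_of_forall_le fun j hj => ?_
      interval_cases j <;> assumption
    · rw [← isNull_act (det_upper (-extend a 3 / (3 * extend a 2)))]
      generalize hc : -extend a 3 / (3 * extend a 2) = c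
      obtain ⟨e0, ek, eI⟩ := shift c
      have e1 : extend (act !![1, c; 0, 1] a) 1 = 0 := by
        rw [extend_act_upper c a (by omega)]
        simp [Finset.sum_range_succ, h0, h1]
      have e2 : extend (act !![1, c; 0, 1] a) 2 ≠ 0 := by
        rw [extend_act_upper c a (by omega)]
        simpa [Finset.sum_range_succ, h0, h1] using h2
      have e3 : extend (act !![1, c; 0, 1] a) 3 = 0 := by
        rw [extend_act_upper c a (by omega), ← hc]
        simp [Finset.sum_range_succ, h0, h1]
        field_simp
        ring
      generalize act !![1, c; 0, 1] a = a' at *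
      have k0 := ek 0 (by omega)
      have k1 := ek 1 (by omega)
      have k2 := ek 2 (by omega)
      have k3 := ek 3 (by omega)
      have i3 := congrFun eI 1
      rw [kCoeff_zero] at k0
      rw [kCoeff_one] at k1
      rw [kCoeff_two, smul_eq_mul] at k2
      rw [kCoeff_three] at k3
      rw [octInv_one, Pi.zero_apply] at i3
      have e4 : extend a' 4 = 0 := by simpa [e0, e1, e2, e3] using k0
      have e5 : extend a' 5 = 0 := by simpa [e0, e1, e2, e3, e4] using k1
      have e6 : extend a' 6 = 0 := by simpa [e0, e1, e2, e3, e4] using k2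
      have e7 : extend a' 7 = 0 := by simpa [e0, e1, e2, e3, e4] using k3
      have e8 : extend a' 8 = 0 := by simpa [e0, e1, e2, e3, e4, e5, e6] using i3
      refine isNull_of_forall_ge fun j hj hj8 => ?_
      interval_cases j <;> assumption
  · rw [← isNull_act (det_upper (-extend a 2 / (2 * extend a 1)))]
    generalize hc : -extend a 2 / (2 * extend a 1) = c
    obtain ⟨e0, ek, eI⟩ := shift c
    have e1 : extend (act !![1, c; 0, 1] a) 1 ≠ 0 := by
      rw [extend_act_upper c a (by omega)]
      simpa [Finset.sum_range_succ, h0] using h1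
    have e2 : extend (act !![1, c; 0, 1] a) 2 = 0 := by
      rw [extend_act_upper c a (by omega), ← hc]
      simp [Finset.sum_range_succ, h0]
      field_simp
      ring
    generalize act !![1, c; 0, 1] a = a' at *
    have k0 := ek 0 (by omega)
    have k1 := ek 1 (by omega)
    have k2 := ek 2 (by omega)
    have k3 := ek 3 (by omega)
    have i2 := congrFun eI 0
    rw [kCoeff_zero] at k0
    rw [kCoeff_one] at k1
    rw [kCoeff_two, smul_eq_mul] at k2
    rw [kCoeff_three] at k3
    rw [octInv_zero, Pi.zero_apply] at i2
    obtain ⟨s, hs3, hs4⟩ : ∃ s, extend a' 3 = -3 * s ^ 2 * extend a' 1 ∧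
        extend a' 4 = 8 * s ^ 3 * extend a' 1 := by
      have h34 : 64 * extend a' 3 ^ 3 = -27 * extend a' 1 * extend a' 4 ^ 2 := by
        rw [e0, e2] at k0 k2 i2
        grind
      by_cases e3 : extend a' 3 = 0
      · exact ⟨0, by simpa using e3, by simpa [e1, e3] using h34⟩
      · refine ⟨-3 * extend a' 4 / (8 * extend a' 3), ?_, ?_⟩
        · field_simp
          linear_combination h34
        · field_simp
          linear_combination extend a' 4 * h34
    simp only [e0, e2, hs3, hs4] at k0 k1 k2 k3
    have e5 : extend a' 5 = -15 * s ^ 4 * extend a' 1 := by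
      refine mul_left_cancel₀ e1 ?_
      linear_combination (-1/12 : ℂ) * k0
    have e6 : extend a' 6 = 24 * s ^ 5 * extend a' 1 := by
      refine mul_left_cancel₀ e1 ?_
      linear_combination (-1/5 : ℂ) * k1
    rw [e5] at k2 k3
    have e7 : extend a' 7 = -35 * s ^ 6 * extend a' 1 := by
      refine mul_left_cancel₀ e1 ?_
      linear_combination (-3/2 : ℂ) * k2
    rw [e6] at k3
    have e8 : extend a' 8 = 48 * s ^ 7 * extend a' 1 := by
      refine mul_left_cancel₀ e1 ?_
      linear_combination k3
    rw [← isNull_act (det_upper s)]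
    refine isNull_of_forall_ge fun j hj hj8 => ?_
    rw [extend_act_upper s a' hj8]
    interval_cases j <;>
    · simp [Finset.sum_range_succ, e0, e2, hs3, hs4, e5, e6, e7, e8, Nat.choose]
      try ring

/-- An octavic with vanishing invariants cannot have covariant `k` proportional to `x y³`. -/
theorem kCoeff_three_eq_zero {a : Fin 9 → ℂ} (hI : octInv (extend a) = 0)
    (h0 : kCoeff (extend a) 0 = 0) (h1 : kCoeff (extend a) 1 = 0) (h2 : kCoeff (extend a) 2 = 0)
    (h4 : kCoeff (extend a) 4 = 0) : kCoeff (extend a) 3 = 0 := by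
  by_contra h3
  have i2 := congrFun hI 0
  have i3 := congrFun hI 1
  have i5 := congrFun hI 3
  have i7 := congrFun hI 5
  rw [octInv_zero, Pi.zero_apply] at i2
  rw [octInv_one, Pi.zero_apply] at i3
  simp only [octInv_three, h0, h1, h2, h4, Pi.zero_apply] at i5
  rw [mCoeff_eq _ (by omega : 1 ≤ 4)] at i5
  have a2 : extend a 2 = 0 := by
    simpa [h0, h1, h2, h4, h3] using i5
  have a1 : extend a 1 = 0 := by
    rw [octInv_five, hCoeff_zero, hCoeff_one, hCoeff_two, hCoeff_three, hCoeff_four,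
      mCoeff_eq _ (by omega : 0 ≤ 4)] at i7
    simpa [h0, h1, h2, h4, h3] using i7
  rw [kCoeff_zero] at h0
  rw [kCoeff_one] at h1
  rw [kCoeff_two, smul_eq_mul] at h2
  rw [kCoeff_three] at h3
  rw [kCoeff_four] at h4
  simp only [a1, a2] at h0 h1 h2 h3 h4 i2 i3
  generalize extend a 0 = x0 at *
  generalize extend a 3 = x3 at *
  generalize extend a 4 = x4 at *
  generalize extend a 5 = x5 at *
  generalize extend a 6 = x6 at *
  generalize extend a 7 = x7 at *
  generalize extend a 8 = x8 at *
  have h35 : 3 * (x3 * x5) = 2 * x4 ^ 2 := by linear_combination (1/10 : ℂ) * h2 - (1/60 : ℂ) * i2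
  have h06 : x0 * x6 = 10 * x3 ^ 2 := by linear_combination (1/2 : ℂ) * h0
  have h07 : x0 * x7 = 5 * (x3 * x4) := by linear_combination h1
  by_cases hx0 : x0 = 0
  · rw [hx0] at h06
    have hx3 : x3 = 0 := by simpa using h06.symm
    have hx4 : x4 = 0 := by simpa [hx3] using h35.symm
    exact h3 (by rw [hx3, hx4]; ring)
  have h55 : x0 * x5 ^ 2 = 12 * (x3 ^ 2 * x4) := by
    linear_combination (-1/20 : ℂ) * x0 * h4 + (3/2 : ℂ) * x4 * h06 - (3/5 : ℂ) * x3 * h07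
  by_cases hx4 : x4 = 0
  · have hx5 : x5 = 0 := by simpa [hx4, hx0] using h55
    have hx3 : x3 = 0 := by
      have hx : x3 ^ 4 = 0 := by
        rw [hx4, hx5] at i3
        linear_combination (x0 * i3 - (18 * (x0 * x6 + 10 * x3 ^ 2) + 144 * x3 ^ 2) * h06) / 3240
      simpa using hx
    exact h3 (by rw [hx3, hx4]; ring)
  · have hx3 : x3 ≠ 0 := fun h => hx4 (by simpa [h] using h35.symm)
    have h43 : x0 * x4 ^ 3 = 27 * x3 ^ 4 := by
      refine mul_left_cancel₀ hx4 ?_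
      linear_combination (9/4 : ℂ) * x3 ^ 2 * h55 -
        (1/4 : ℂ) * x0 * (3 * (x3 * x5) + 2 * x4 ^ 2) * h35
    refine h3 ?_
    have : x0 * x3 * (0 * x8 - 5 * 0 * x7 + 9 * x3 * x6 - 5 * x4 * x5) = 0 := by
      linear_combination 9 * x3 ^ 2 * h06 - (5/3 : ℂ) * x0 * x4 * h35 - (10/3 : ℂ) * h43
    simpa [hx0, hx3] using this

/-- The six invariants cut out the nullcone. -/
theorem isNull_of_octInv_eq_zero {a : Fin 9 → ℂ} (hI : octInv (extend a) = 0) : IsNull a := by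
  have act_zero : ∀ {M : Matrix (Fin 2) (Fin 2) ℂ}, M.det = 1 → ∀ {a : Fin 9 → ℂ},
      octInv (extend a) = 0 → octInv (extend (act M a)) = 0 := fun hM a h => by
    rw [octInv_act hM, h]
  have case_four : ∀ a : Fin 9 → ℂ, octInv (extend a) = 0 →
      (∀ j < 4, kCoeff (extend a) j = 0) → IsNull a := by
    intro a hI hk
    by_cases h4 : kCoeff (extend a) 4 = 0
    · obtain ⟨M, hM, h0⟩ := exists_act_zero_eq_zero (by omega : 0 < 8) a
      rw [← isNull_act hM]
      refine isNull_of_kCoeff_eq_zero h0 (fun j hj => ?_) (act_zero hM hI)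
      have hz : (fun i : Fin 5 => kCoeff (extend a) i) = 0 := by
        ext i
        obtain ⟨i, hi⟩ := i
        rcases Nat.lt_or_ge i 4 with h | h
        · exact hk i h
        · obtain rfl : i = 4 := by omega
          exact h4
      rw [kCoeff_act_eq hM a hj.le, hz]
      have h00 : act M (0 : Fin 5 → ℂ) = 0 := by
        ext i
        simp [act, formOf, coeffOf]
      rw [h00]
      unfold extend
      split_ifs <;> rfl
    · refine isNull_of_kCoeff_eq_zero ?_ hk hI
      have i5 := congrFun hI 3
      rw [octInv_three, mCoeff_eq _ (by omega : 0 ≤ 4)] at i5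
      simpa [hk 0, hk 1, hk 2, hk 3, h4] using i5
  have case_three : ∀ a : Fin 9 → ℂ, octInv (extend a) = 0 →
      (∀ j < 3, kCoeff (extend a) j = 0) → IsNull a := by
    intro a hI hk
    have h3 : kCoeff (extend a) 3 = 0 := by
      by_contra h3
      have hc := kCoeff_act_upper (-kCoeff (extend a) 4 / (4 * kCoeff (extend a) 3)) a le_rfl
      generalize hc' : -kCoeff (extend a) 4 / (4 * kCoeff (extend a) 3) = c at hc
      have hj : ∀ j < 3, kCoeff (extend (act !![1, c; 0, 1] a)) j = 0 := fun j hj => by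
        rw [kCoeff_act_upper c a (by omega)]
        refine Finset.sum_eq_zero fun i hi => ?_
        rw [hk i (by have := Finset.mem_range.mp hi; omega), mul_zero]
      have h := kCoeff_three_eq_zero (act_zero (det_upper c) hI) (hj 0 (by omega))
        (hj 1 (by omega)) (hj 2 (by omega)) (by
          rw [hc, ← hc']
          simp [Finset.sum_range_succ, hk 0, hk 1, hk 2, Nat.choose]
          field_simp
          ring)
      rw [kCoeff_act_upper c a (by omega)] at h
      simp [Finset.sum_range_succ, hk 0, hk 1, hk 2] at h
      exact h3 h
    refine case_four a hI fun j hj => ?_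
    rcases Nat.lt_or_ge j 3 with h | h
    · exact hk j h
    · obtain rfl : j = 3 := by omega
      exact h3
  have case_zero : ∀ a : Fin 9 → ℂ, octInv (extend a) = 0 → kCoeff (extend a) 0 = 0 →
      IsNull a := by
    intro a hI h0
    have i4 := congrFun hI 2
    rw [octInv_two, Pi.zero_apply, h0] at i4
    by_cases h1 : kCoeff (extend a) 1 = 0
    · have h2 : kCoeff (extend a) 2 = 0 := by
        simpa [h1] using i4
      refine case_three a hI fun j hj => ?_
      interval_cases j <;> assumption
    · have hc := fun j hj => kCoeff_act_upper
        (-kCoeff (extend a) 2 / (2 * kCoeff (extend a) 1)) a (j := j) hj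
      generalize hc' : -kCoeff (extend a) 2 / (2 * kCoeff (extend a) 1) = c at hc
      have e0 : kCoeff (extend (act !![1, c; 0, 1] a)) 0 = 0 := by
        rw [hc 0 (by omega)]
        simp [h0]
      have e1 : kCoeff (extend (act !![1, c; 0, 1] a)) 1 ≠ 0 := by
        rw [hc 1 (by omega)]
        simpa [Finset.sum_range_succ, h0] using h1
      have e2 : kCoeff (extend (act !![1, c; 0, 1] a)) 2 = 0 := by
        rw [hc 2 (by omega), ← hc']
        simp [Finset.sum_range_succ, h0]
        field_simp
        ring
      have eI := act_zero (det_upper c) hI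
      rw [← isNull_act (det_upper c)]
      generalize act !![1, c; 0, 1] a = a' at *
      have i4 := congrFun eI 2
      have i6 := congrFun eI 4
      rw [octInv_two, Pi.zero_apply] at i4
      rw [octInv_four, Pi.zero_apply] at i6
      have e3 : kCoeff (extend a') 3 = 0 := by
        simpa [e0, e1, e2] using i4
      have e4 : kCoeff (extend a') 4 = 0 := by
        simpa [e0, e1, e2, e3] using i6
      rw [← isNull_act det_rev]
      refine case_three _ (act_zero det_rev eI) fun j hj => ?_
      rw [kCoeff_act_rev _ (by omega)]
      interval_cases j <;> assumption
  obtain ⟨M, hM, h0⟩ := exists_act_zero_eq_zero (by omega : 0 < 4)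
    fun i : Fin 5 => kCoeff (extend a) i
  rw [← isNull_act hM]
  refine case_zero _ (act_zero hM hI) ?_
  rw [kCoeff_act_eq hM a (by omega), h0]

end NullconeOctavic

section Jacobian

theorem derivation_aeval {σ ι : Type} [Fintype ι]
    (D : Derivation ℂ (MvPolynomial σ ℂ) (MvPolynomial σ ℂ)) (v : ι → MvPolynomial σ ℂ)
    (P : MvPolynomial ι ℂ) :
    D (aeval v P) = ∑ j, D (v j) * aeval v (pderiv j P) := by
  classical
  induction P using MvPolynomial.induction_on with
  | C c => simp
  | add p q hp hq => simp only [map_add, hp, hq, mul_add, Finset.sum_add_distrib]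
  | mul_X p i hp =>
    simp only [map_mul, aeval_X, Derivation.leibniz, hp, smul_eq_mul, pderiv_X, map_add, mul_add,
      Finset.sum_add_distrib, Finset.mul_sum]
    congr 1
    · rw [Finset.sum_eq_single i]
      · simp [mul_comm]
      · intro j _ hj
        simp [Pi.single_eq_of_ne hj.symm]
      · simp
    · exact Finset.sum_congr rfl fun j _ => by ring

/-- The Jacobian criterion for algebraic independence. -/
theorem algebraicIndependent_of_det_ne_zero {σ ι : Type} [Fintype ι] [DecidableEq ι]
    (s : ι → σ) (v : ι → MvPolynomial σ ℂ)
    (h : (Matrix.of fun i j => pderiv (s i) (v j)).det ≠ 0) : AlgebraicIndependent ℂ v := by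
  have hder : ∀ P : MvPolynomial ι ℂ, aeval v P = 0 → ∀ j, aeval v (pderiv j P) = 0 := by
    intro P hP
    refine congrFun (Matrix.eq_zero_of_mulVec_eq_zero h (funext fun i => ?_))
    have := derivation_aeval (pderiv (s i)) v P
    rw [hP, map_zero] at this
    exact this.symm
  have key : ∀ (N : ℕ) (P : MvPolynomial ι ℂ), aeval v P = 0 →
      (∀ m : ι →₀ ℕ, N ≤ m.degree → coeff m P = 0) → P = 0 := by
    intro N
    induction N with
    | zero => exact fun P _ hc => MvPolynomial.ext _ _ fun m => hc m (Nat.zero_le _)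
    | succ N ih =>
      intro P hP hc
      have hd : ∀ j, pderiv j P = 0 := fun j => by
        refine ih _ (hder P hP j) fun m hm => ?_
        rw [coeff_pderiv, hc _ (by rw [map_add, Finsupp.degree_single]; omega), zero_mul]
      have hP0 : P = C (coeff 0 P) := by
        classical
        ext m
        rw [coeff_C]
        split_ifs with hm
        · rw [hm]
        · obtain ⟨j, hj⟩ := Finsupp.ne_iff.mp (Ne.symm hm)
          have h1 : m = m - Finsupp.single j 1 + Finsupp.single j 1 := by
            rw [tsub_add_cancel_of_le]
            rw [Finsupp.single_le_iff]
            exact Nat.one_le_iff_ne_zero.mpr hj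
          have h2 := coeff_pderiv (i := j) P (m - Finsupp.single j 1)
          rw [hd, coeff_zero, ← h1, eq_comm, mul_eq_zero] at h2
          exact h2.resolve_right (Nat.cast_add_one_ne_zero _)
      rw [hP0, aeval_C, algebraMap_eq, C_eq_zero] at hP
      rw [hP0, hP, C_0]
  rw [algebraicIndependent_iff]
  exact fun P hP => key (P.totalDegree + 1) P hP fun m hm =>
    coeff_eq_zero_of_totalDegree_lt hm

open DualNumber in
theorem snd_aeval_eq_eval_pderiv {σ : Type} [DecidableEq σ] (p : σ → ℂ) (i : σ)
    (P : MvPolynomial σ ℂ) :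
    aeval (fun j => (TrivSqZeroExt.inl (p j) + if j = i then ε else 0 : DualNumber ℂ)) P =
      TrivSqZeroExt.inl (eval p P) + TrivSqZeroExt.inr (eval p (pderiv i P)) := by
  induction P using MvPolynomial.induction_on with
  | C c => simp [TrivSqZeroExt.algebraMap_eq_inl]
  | add p q hp hq =>
    rw [map_add, hp, hq]
    ext <;> simp
  | mul_X q j hq =>
    rw [map_mul, hq, aeval_X]
    ext
    · split_ifs <;> simp
    · rcases eq_or_ne j i with rfl | hj
      · simp [Derivation.leibniz]
        ring
      · simp [Derivation.leibniz, hj, pderiv_X_of_ne hj]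
        ring

end Jacobian

section Independence

/-- The octavic `56 x⁵ y³ + 28 x² y⁶`, where the differentials of the invariants are independent. -/
def basePoint (j : Fin 9) : ℂ := if j = 3 ∨ j = 6 then 1 else 0

open DualNumber in
theorem eval_pderiv_octInv (i : Fin 9) (j : Fin 6) :
    eval basePoint (pderiv i (octInv (extend X : ℕ → MvPolynomial (Fin 9) ℂ) j)) =
      (octInv (extend fun l => (TrivSqZeroExt.inl (basePoint l) +
        if l = i then ε else 0 : DualNumber ℂ)) j).snd := by
  have h := snd_aeval_eq_eval_pderiv basePoint i (octInv (extend X : ℕ → MvPolynomial (Fin 9) ℂ) j)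
  rw [map_octInv] at h
  have h2 : (fun l => aeval (fun j => (TrivSqZeroExt.inl (basePoint j) +
      if j = i then ε else 0 : DualNumber ℂ)) (extend X l : MvPolynomial (Fin 9) ℂ)) =
      extend fun l => (TrivSqZeroExt.inl (basePoint l) + if l = i then ε else 0) := by
    ext1 l
    rw [← AlgHom.coe_toRingHom, map_extend]
    simp
  rw [h2] at h
  rw [h]
  simp

theorem fst_ofNat (k : ℕ) [k.AtLeastTwo] :
    (ofNat(k) : DualNumber ℂ).fst = ofNat(k) := rfl

theorem snd_ofNat (k : ℕ) [k.AtLeastTwo] : (ofNat(k) : DualNumber ℂ).snd = 0 := rfl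

/-- The differentials of the six invariants at `basePoint`. -/
theorem snd_octInv {a : ℕ → DualNumber ℂ}
    (ha : ∀ l ≤ 8, (a l).fst = if l = 3 ∨ l = 6 then 1 else 0) (j : Fin 6) :
    (octInv a j).snd = ![56 * (a 2).snd - 112 * (a 5).snd,
      18 * (a 0).snd + 288 * (a 3).snd + 144 * (a 6).snd,
      360 * (a 1).snd - 840 * (a 4).snd + 480 * (a 7).snd,
      3088 * (a 2).snd - 6176 * (a 5).snd + 400 * (a 8).snd,
      -972 * (a 0).snd + 38880 * (a 3).snd + 19440 * (a 6).snd,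
      27072 * (a 1).snd + 87360 * (a 4).snd - 49920 * (a 7).snd] j := by
  have k0 : (kCoeff a 0).fst = -20 ∧ (kCoeff a 0).snd = 2 * (a 0).snd - 40 * (a 3).snd := by
    simp [kCoeff_zero, ha, fst_ofNat, snd_ofNat, pow_two]
    norm_num
    ring
  have k1 : (kCoeff a 1).fst = 0 ∧ (kCoeff a 1).snd = -5 * (a 1).snd - 5 * (a 4).snd := by
    simp [kCoeff_one, ha, fst_ofNat, snd_ofNat]
  have k2 : (kCoeff a 2).fst = 0 ∧
      (kCoeff a 2).snd = -8 / 3 * (a 2).snd + 34 / 3 * (a 5).snd := by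
    simp [kCoeff_two, ha, fst_ofNat, snd_ofNat, pow_two]
    ring
  have k3 : (kCoeff a 3).fst = 9 ∧ (kCoeff a 3).snd = 9 * (a 3).snd + 9 * (a 6).snd := by
    simp [kCoeff_three, ha, fst_ofNat, snd_ofNat]
    ring
  have k4 : (kCoeff a 4).fst = 0 ∧ (kCoeff a 4).snd = -12 * (a 7).snd + 30 * (a 4).snd := by
    simp [kCoeff_four, ha, fst_ofNat, snd_ofNat, pow_two]
    ring
  fin_cases j
  · simp [octInv_zero, ha, fst_ofNat, snd_ofNat, pow_two]
    ring
  · simp [octInv_one, ha, fst_ofNat, snd_ofNat, pow_two]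
    ring
  · simp [octInv_two, k0, k1, k2, k3, k4, fst_ofNat, snd_ofNat, pow_two]
    ring
  · simp [octInv_three, mCoeff_eq, ha, k0, k1, k2, k3, k4, fst_ofNat, snd_ofNat]
    ring
  · simp [octInv_four, k0, k1, k2, k3, k4, fst_ofNat, snd_ofNat, pow_succ]
    ring
  · simp [octInv_five, mCoeff_eq, hCoeff_zero, hCoeff_one, hCoeff_two, hCoeff_three, hCoeff_four,
      ha, k0, k1, k2, k3, k4, fst_ofNat, snd_ofNat, pow_two]
    ring

theorem algebraicIndependent_octInv :
    AlgebraicIndependent ℂ (octInv (extend X : ℕ → MvPolynomial (Fin 9) ℂ)) := by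
  refine algebraicIndependent_of_det_ne_zero ![2, 0, 1, 8, 3, 4] _ fun h => ?_
  have h2 := congrArg (eval basePoint) h
  rw [RingHom.map_det, map_zero] at h2
  have h3 : (eval basePoint).mapMatrix (Matrix.of fun i j =>
      pderiv (![2, 0, 1, 8, 3, 4] i : Fin 9) (octInv (extend X) j)) =
      !![56, 0, 0, 3088, 0, 0; 0, 18, 0, 0, -972, 0; 0, 0, 360, 0, 0, 27072;
        0, 0, 0, 400, 0, 0; 0, 288, 0, 0, 38880, 0; 0, 0, -840, 0, 0, 87360] := by
    ext i j
    rw [RingHom.mapMatrix_apply, Matrix.map_apply, Matrix.of_apply, eval_pderiv_octInv, snd_octInv]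
    · fin_cases i <;> fin_cases j <;> simp [extend, Fin.ext_iff]
    · intro l hl
      rw [extend, dif_pos (Nat.lt_succ_iff.mpr hl)]
      split_ifs <;> simp_all [basePoint, Fin.ext_iff]
  rw [h3] at h2
  simp [Matrix.det_succ_row_zero, Fin.sum_univ_succ, Fin.succAbove] at h2
  norm_num at h2

end Independence

end BinaryForm

/-- For `f ∈ V₈`, set `k = (f,f)₆` and `m = (f,k)₄`. The six invariants `f ↦ (f,f)₈`,
`f ↦ ((f,f)₄,f)₈`, `f ↦ (k,k)₄`, `f ↦ (m,k)₄`, `f ↦ ((k,k)₂,k)₄` and `f ↦ ((k,k)₂,m)₄`,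
homogeneous of degrees 2, 3, 4, 5, 6 and 7 in the coefficients, form a homogeneous
system of parameters of the algebra `O(V₈)^{SL₂}` of polynomial invariants of the
binary octavic. -/
theorem octavic_hsop :
    octI2.IsHomogeneous 2 ∧ octI3.IsHomogeneous 3 ∧ octI4.IsHomogeneous 4 ∧
    octI5.IsHomogeneous 5 ∧ octI6.IsHomogeneous 6 ∧ octI7.IsHomogeneous 7 ∧
    IsHSOP 8 ![octI2, octI3, octI4, octI5, octI6, octI7] := by
  have hhom (j : Fin 6) :
      (![octI2, octI3, octI4, octI5, octI6, octI7] j).IsHomogeneous (j + 2) := by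
    rw [BinaryForm.octI_eq]
    exact BinaryForm.isHomogeneous_octInv j
  have hmem (j : Fin 6) :
      ![octI2, octI3, octI4, octI5, octI6, octI7] j ∈ invariantAlgebra 8 := by
    rw [BinaryForm.octI_eq]
    exact BinaryForm.octInv_mem_invariantAlgebra j
  refine ⟨hhom 0, hhom 1, hhom 2, hhom 3, hhom 4, hhom 5, hmem, fun j => ⟨_, hhom j⟩, ?_, ?_⟩
  · rw [BinaryForm.octI_eq]
    exact BinaryForm.algebraicIndependent_octInv
  · refine BinaryForm.exists_finset_span_adjoin hmem hhom (fun _ => Nat.succ_pos _) fun a ha => ?_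
    refine BinaryForm.isNull_of_octInv_eq_zero (funext fun j => ?_)
    rw [← BinaryForm.aeval_octInv, ← BinaryForm.octI_eq]
    exact ha j
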